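/- Let A and B be m×m real symmetric matrices. Then there exists an m×m real orthogonal matrix R such that A and RᵀBR are in finite free position; that is, det(xI − yA − zRᵀBR) = [det(xI − yA) ⊞_m det(xI − zB)] as polynomials in x, for all real y, z. -/

import Mathlib

open Polynomial Matrix

/-- The symmetric additive convolution of two polynomials of degree (at most) `m`:
`[p ⊞_m q](x) = (1/m!) ∑_{i=0}^m p^{(i)}(x) · q^{(m-i)}(0)`. -/
noncomputable def boxplus (m : ℕ) (p q : ℝ[X]) : ℝ[X] :=
  (m.factorial : ℝ)⁻¹ •
    ∑ i ∈ Finset.range (m + 1),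
      C ((Polynomial.derivative^[m - i] q).eval 0) * Polynomial.derivative^[i] p

/-- Two `m × m` real symmetric matrices `A`, `B` are in finite free position if
`det(xI - yA - zB) = [det(xI - yA) ⊞_m det(xI - zB)]` for all real `y, z`. -/
def FiniteFreePosition (m : ℕ) (A B : Matrix (Fin m) (Fin m) ℝ) : Prop :=
  ∀ y z : ℝ, (y • A + z • B).charpoly = boxplus m (y • A).charpoly (z • B).charpoly

section Sard

open MeasureTheory Set Topology

theorem exists_continuousLinearMap_ker_eq_span {V : Type*} [NormedAddCommGroup V]
    [NormedSpace ℝ V] [FiniteDimensional ℝ V] {n : ℕ} (hn : Module.finrank ℝ V = n + 1)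
    {w : V} (hw : w ≠ 0) :
    ∃ ρ : V →L[ℝ] (Fin n → ℝ), Function.Surjective ρ ∧ ∀ v, ρ v = 0 ↔ ∃ c : ℝ, v = c • w := by
  have hq : Module.finrank ℝ (V ⧸ (ℝ ∙ w)) = Module.finrank ℝ (Fin n → ℝ) := by
    have h := Submodule.finrank_quotient_add_finrank (ℝ ∙ w)
    rw [finrank_span_singleton hw] at h
    simp; omega
  let e := LinearEquiv.ofFinrankEq _ _ hq
  refine ⟨LinearMap.toContinuousLinearMap (e.toLinearMap ∘ₗ (ℝ ∙ w).mkQ), ?_, fun v => ?_⟩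
  · exact e.surjective.comp (Submodule.mkQ_surjective _)
  · rw [LinearMap.coe_toContinuousLinearMap', LinearMap.comp_apply, LinearEquiv.coe_coe,
      LinearEquiv.map_eq_zero_iff, Submodule.mkQ_apply, Submodule.Quotient.mk_eq_zero,
      Submodule.mem_span_singleton]
    exact exists_congr fun c => eq_comm

theorem volume_image_eq_zero_of_subset_hypersurface {V : Type*} [NormedAddCommGroup V]
    [NormedSpace ℝ V] [FiniteDimensional ℝ V] {n : ℕ} (hn : Module.finrank ℝ V = n + 1)
    {G : V → Fin n → ℝ} (hG : ContDiff ℝ 1 G) {h : V → ℝ} (hh : ContDiff ℝ 1 h) (w : V)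
    {S : Set V} (hS0 : ∀ v ∈ S, h v = 0) (hSw : ∀ v ∈ S, fderiv ℝ h v w ≠ 0)
    (hSk : ∀ v ∈ S, 2 ≤ Module.finrank ℝ (fderiv ℝ G v).ker) :
    volume (G '' S) = 0 := by
  rcases S.eq_empty_or_nonempty with rfl | ⟨v₀, hv₀⟩
  · simp
  have hw : w ≠ 0 := by
    rintro rfl
    exact hSw v₀ hv₀ (map_zero _)
  obtain ⟨ρ, -, hρ⟩ := exists_continuousLinearMap_ker_eq_span hn hw
  let Φ : V → (Fin n → ℝ) × ℝ := fun v => (ρ v, h v)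
  have hΦ : ContDiff ℝ 1 Φ := ρ.contDiff.prodMk hh
  have hder : ∀ v, HasFDerivAt Φ (ρ.prod (fderiv ℝ h v)) v := fun v =>
    ρ.hasFDerivAt.prodMk (hh.differentiable (by norm_num) v).hasFDerivAt
  have hequiv : ∀ v ∈ S, ∃ L : V ≃L[ℝ] (Fin n → ℝ) × ℝ,
      (L : V →L[ℝ] (Fin n → ℝ) × ℝ) = ρ.prod (fderiv ℝ h v) := by
    intro v hv
    have hinj : Function.Injective (ρ.prod (fderiv ℝ h v)) := by
      rw [injective_iff_map_eq_zero]
      intro x hx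
      rw [ContinuousLinearMap.prod_apply, Prod.mk_eq_zero] at hx
      obtain ⟨c, rfl⟩ := (hρ x).1 hx.1
      have := hx.2
      rw [map_smul, smul_eq_mul, mul_eq_zero] at this
      rcases this with rfl | h'
      · simp
      · exact absurd h' (hSw v hv)
    refine ⟨(LinearEquiv.ofInjectiveOfFinrankEq (ρ.prod (fderiv ℝ h v)).toLinearMap hinj
      (by simp [hn])).toContinuousLinearEquiv, ?_⟩
    ext x <;> rfl
  have hloc : ∀ v ∈ S, ∃ W ∈ 𝓝 v, volume (G '' (S ∩ W)) = 0 := by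
    intro v hv
    obtain ⟨L, hL⟩ := hequiv v hv
    have hd : HasFDerivAt Φ (L : V →L[ℝ] (Fin n → ℝ) × ℝ) v := hL ▸ hder v
    let e := hΦ.contDiffAt.toOpenPartialHomeomorph Φ hd (by norm_num)
    have he : ∀ x, e x = Φ x := fun x => rfl
    refine ⟨e.source, e.open_source.mem_nhds
      (hΦ.contDiffAt.mem_toOpenPartialHomeomorph_source hd (by norm_num)), ?_⟩
    let ψ : (Fin n → ℝ) → V := fun u => e.symm (u, 0)
    have hψ : ∀ x ∈ S ∩ e.source, ψ (ρ x) = x := by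
      rintro x ⟨hx, hxe⟩
      have : ((ρ x, 0) : (Fin n → ℝ) × ℝ) = e x := by rw [he]; simp [Φ, hS0 x hx]
      simp only [ψ, this]
      exact e.left_inv hxe
    have himg : G '' (S ∩ e.source) = (G ∘ ψ) '' (ρ '' (S ∩ e.source)) := by
      rw [image_image]
      exact image_congr fun x hx => by rw [Function.comp_apply, hψ x hx]
    rw [himg]
    have key : ∀ u ∈ ρ '' (S ∩ e.source), ∃ f' : (Fin n → ℝ) →L[ℝ] (Fin n → ℝ),
        HasFDerivAt (G ∘ ψ) f' u ∧ f'.det = 0 := by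
      rintro _ ⟨x, hx, rfl⟩
      obtain ⟨Lx, hLx⟩ := hequiv x hx.1
      have hdx : HasFDerivAt e (Lx : V →L[ℝ] (Fin n → ℝ) × ℝ) x := hLx ▸ hder x
      have hpt : ((ρ x, 0) : (Fin n → ℝ) × ℝ) = e x := by rw [he]; simp [Φ, hS0 x hx.1]
      have hsymm : HasFDerivAt e.symm (Lx.symm : (Fin n → ℝ) × ℝ →L[ℝ] V) (ρ x, 0) := by
        apply e.hasFDerivAt_symm
        · rw [hpt]; exact e.map_source hx.2
        · rwa [hpt, e.left_inv hx.2]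
      have hψd : HasFDerivAt ψ ((Lx.symm : (Fin n → ℝ) × ℝ →L[ℝ] V).comp
          (ContinuousLinearMap.inl ℝ (Fin n → ℝ) ℝ)) (ρ x) :=
        HasFDerivAt.comp (g := e.symm) (ρ x) hsymm (hasFDerivAt_prodMk_left (ρ x) (0 : ℝ))
      have hGd : HasFDerivAt G (fderiv ℝ G x) (ψ (ρ x)) := by
        rw [hψ x hx]
        exact (hG.differentiable (by norm_num) x).hasFDerivAt
      refine ⟨_, hGd.comp (ρ x) hψd, ?_⟩
      -- a kernel vector tangent to the hypersurface
      obtain ⟨κ, hκ0, hκG, hκh⟩ : ∃ κ : V, κ ≠ 0 ∧ fderiv ℝ G x κ = 0 ∧ fderiv ℝ h x κ = 0 := by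
        let T : (fderiv ℝ G x).ker →ₗ[ℝ] ℝ :=
          (fderiv ℝ h x).toLinearMap ∘ₗ (fderiv ℝ G x).ker.subtype
        have hlt : Module.finrank ℝ ℝ < Module.finrank ℝ (fderiv ℝ G x).ker := by
          rw [Module.finrank_self]; exact hSk x hx.1
        obtain ⟨κ, hκ, hκ0⟩ := (Submodule.ne_bot_iff _).1
          (LinearMap.ker_ne_bot_of_finrank_lt (f := T) hlt)
        exact ⟨κ, fun h0 => hκ0 (Subtype.ext h0), κ.2, hκ⟩
      have hLκ : Lx κ = (ρ κ, 0) := by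
        have : Lx κ = (ρ.prod (fderiv ℝ h x)) κ := by rw [← hLx]; rfl
        rw [this, ContinuousLinearMap.prod_apply, hκh]
      have hρκ : ρ κ ≠ 0 := by
        intro h0
        apply hκ0
        apply Lx.injective
        rw [hLκ, h0, map_zero]; rfl
      by_contra hdet
      apply hρκ
      have hu : IsUnit (LinearMap.det (((fderiv ℝ G x).comp
          ((Lx.symm : (Fin n → ℝ) × ℝ →L[ℝ] V).comp
          (ContinuousLinearMap.inl ℝ (Fin n → ℝ) ℝ))).toLinearMap)) := isUnit_iff_ne_zero.2 hdet
      apply ((Module.End.isUnit_iff _).1 ((LinearMap.isUnit_iff_isUnit_det _).2 hu)).1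
      rw [map_zero]
      change fderiv ℝ G x (Lx.symm (ρ κ, 0)) = 0
      rw [← hLκ, ContinuousLinearEquiv.symm_apply_apply, hκG]
    choose! f' hf' using key
    exact addHaar_image_eq_zero_of_det_fderivWithin_eq_zero volume (f' := f')
      (fun u hu => (hf' u hu).1.hasFDerivWithinAt) (fun u hu => (hf' u hu).2)
  choose! W hW hWv using hloc
  obtain ⟨t, htS, htc, hcov⟩ := TopologicalSpace.countable_cover_nhdsWithin
    (fun v hv => mem_nhdsWithin_of_mem_nhds (hW v hv))
  refine measure_mono_null (t := ⋃ v ∈ t, G '' (S ∩ W v)) ?_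
    ((measure_biUnion_null_iff htc).2 fun v hv => hWv v (htS hv))
  rintro _ ⟨x, hx, rfl⟩
  obtain ⟨v, hv, hxv⟩ := mem_iUnion₂.1 (hcov hx)
  exact mem_iUnion₂.2 ⟨v, hv, x, ⟨hx, hxv⟩, rfl⟩

theorem AnalyticOnNhd.iterate_fderiv_apply {V : Type*} [NormedAddCommGroup V] [NormedSpace ℝ V]
    {J : V → ℝ} (hJ : AnalyticOnNhd ℝ J univ) (w : V) (k : ℕ) :
    AnalyticOnNhd ℝ ((fun (g : V → ℝ) v => fderiv ℝ g v w)^[k] J) univ := by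
  induction k with
  | zero => exact hJ
  | succ k ih =>
    rw [Function.iterate_succ_apply']
    intro v hv
    exact (ContinuousLinearMap.apply ℝ ℝ w).analyticAt _ |>.comp (ih v hv).fderiv

theorem AnalyticOnNhd.iteratedDeriv_comp_line {V : Type*} [NormedAddCommGroup V]
    [NormedSpace ℝ V] {J : V → ℝ} (hJ : AnalyticOnNhd ℝ J univ) (v w : V) (k : ℕ) :
    iteratedDeriv k (fun t : ℝ => J (v + t • w)) =
      fun t => ((fun (g : V → ℝ) v => fderiv ℝ g v w)^[k] J) (v + t • w) := by
  induction k with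
  | zero => simp
  | succ k ih =>
    rw [iteratedDeriv_succ, ih]
    funext t
    rw [Function.iterate_succ_apply']
    have h1 : HasDerivAt (fun t : ℝ => v + t • w) w t := by
      simpa using ((hasDerivAt_id t).smul_const w).const_add v
    have h2 := (hJ.iterate_fderiv_apply w k (v + t • w) (mem_univ _)).differentiableAt.hasFDerivAt
    exact (h2.comp_hasDerivAt t h1).deriv

theorem volume_image_eq_zero_of_analytic_eq_zero {V : Type*} [NormedAddCommGroup V]
    [NormedSpace ℝ V] [FiniteDimensional ℝ V] {n : ℕ} (hn : Module.finrank ℝ V = n + 1)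
    {G : V → Fin n → ℝ} (hG : ContDiff ℝ 1 G) {J : V → ℝ} (hJ : AnalyticOnNhd ℝ J univ)
    {v₀ : V} (hv₀ : J v₀ ≠ 0) {Z : Set V} (hZ0 : ∀ v ∈ Z, J v = 0)
    (hZk : ∀ v ∈ Z, 2 ≤ Module.finrank ℝ (fderiv ℝ G v).ker) :
    volume (G '' Z) = 0 := by
  have : FiniteDimensional ℝ V := inferInstance
  have : ProperSpace V := FiniteDimensional.proper ℝ V
  obtain ⟨Q, hQc, hQd⟩ := TopologicalSpace.exists_countable_dense V
  let D : V → ℕ → V → ℝ := fun w k => (fun (g : V → ℝ) v => fderiv ℝ g v w)^[k] J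
  let S : V → ℕ → Set V := fun w k => {v ∈ Z | D w k v = 0 ∧ fderiv ℝ (D w k) v w ≠ 0}
  have hnull : ∀ w k, volume (G '' S w k) = 0 := by
    intro w k
    exact volume_image_eq_zero_of_subset_hypersurface hn hG
      (contDiff_iff_contDiffAt.2 fun v =>
        ((hJ.iterate_fderiv_apply w k) v (mem_univ _)).contDiffAt) w
      (fun v hv => hv.2.1) (fun v hv => hv.2.2) (fun v hv => hZk v hv.1)
  refine measure_mono_null (t := ⋃ w ∈ Q, ⋃ k, G '' S w k) ?_
    ((measure_biUnion_null_iff hQc).2 fun w _ => measure_iUnion_null fun k => hnull w k)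
  rintro _ ⟨v, hv, rfl⟩
  obtain ⟨w, hwQ, hwo⟩ := hQd.exists_mem_open (U := {w | J (v + w) ≠ 0})
    (isOpen_ne.preimage (hJ.continuous.comp (continuous_const.add continuous_id)))
    ⟨v₀ - v, by simpa using hv₀⟩
  have hline : AnalyticOnNhd ℝ (fun t : ℝ => J (v + t • w)) univ := by
    intro t _
    refine (hJ _ (mem_univ _)).comp ?_
    fun_prop
  have hex : ∃ k, D w k v ≠ 0 := by
    by_contra! hall
    have hord : analyticOrderAt (fun t : ℝ => J (v + t • w)) 0 = ⊤ := by
      rw [ENat.eq_top_iff_forall_ge]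
      intro n
      rw [natCast_le_analyticOrderAt_iff_iteratedDeriv_eq_zero (hline 0 (mem_univ _))]
      intro i _
      rw [hJ.iteratedDeriv_comp_line]
      simpa using hall i
    rw [analyticOrderAt_eq_top] at hord
    have := hline.eqOn_zero_of_preconnected_of_eventuallyEq_zero isPreconnected_univ
      (mem_univ 0) hord (mem_univ 1)
    apply hwo
    simpa using this
  classical
  obtain ⟨k, hk⟩ : ∃ k, Nat.find hex = k + 1 := by
    apply Nat.exists_eq_succ_of_ne_zero
    rw [Ne, Nat.find_eq_zero]
    exact not_not.2 (hZ0 v hv)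
  have h1 : D w k v = 0 := by
    by_contra h
    have := Nat.find_le (h := hex) h
    omega
  have h2 : D w (k + 1) v ≠ 0 := hk ▸ Nat.find_spec hex
  refine mem_iUnion₂.2 ⟨w, hwQ, mem_iUnion.2 ⟨k, v, ⟨hv, h1, ?_⟩, rfl⟩⟩
  simpa only [D, Function.iterate_succ_apply'] using h2

/-- Continuation principle: an analytic map between spaces of equal dimension whose critical
points over a connected open set `U` have at least two-dimensional kernels covers `U` as soon as
its range is closed and it has one regular point over `U`. -/
theorem subset_range_of_finrank_ker {V E : Type*} [NormedAddCommGroup V]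
    [NormedSpace ℝ V] [FiniteDimensional ℝ V] [NormedAddCommGroup E]
    [NormedSpace ℝ E] [FiniteDimensional ℝ E] (hVE : Module.finrank ℝ V = Module.finrank ℝ E)
    {F : V → E} (hF : AnalyticOnNhd ℝ F univ) (hcl : IsClosed (range F))
    {U : Set E} (hU : IsOpen U) (hUc : IsPreconnected U)
    (hker : ∀ v, F v ∈ U → (fderiv ℝ F v).ker = ⊥ ∨ 2 ≤ Module.finrank ℝ (fderiv ℝ F v).ker)
    {v₀ : V} (hv₀ : F v₀ ∈ U) (hreg : (fderiv ℝ F v₀).ker = ⊥) :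
    U ⊆ range F := by
  have : CompleteSpace V := FiniteDimensional.complete ℝ V
  have : CompleteSpace E := FiniteDimensional.complete ℝ E
  have hmem_interior : ∀ v, (fderiv ℝ F v).ker = ⊥ → F v ∈ interior (range F) := by
    intro v hv
    have hsurj : (fderiv ℝ F v).range = ⊤ := by
      have := (LinearMap.injective_iff_surjective_of_finrank_eq_finrank hVE
        (f := (fderiv ℝ F v).toLinearMap)).1 (LinearMap.ker_eq_bot.1 hv)
      exact LinearMap.range_eq_top.2 this
    rw [mem_interior_iff_mem_nhds,
      ← (hF v (mem_univ _)).hasStrictFDerivAt.map_nhds_eq_of_surj hsurj]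
    exact Filter.mem_map.2 (Filter.univ_mem' fun x => mem_range_self x)
  refine (IsPreconnected.subset_of_closure_inter_subset hUc isOpen_interior
    ⟨F v₀, hv₀, hmem_interior v₀ hreg⟩ ?_).trans interior_subset
  rintro u ⟨hucl, huU⟩
  obtain ⟨r, hr, hball⟩ := Metric.isOpen_iff.1 hU u huU
  obtain ⟨w, hwW, hwr⟩ := Metric.mem_closure_iff.1 hucl r hr
  rw [mem_interior_iff_mem_nhds]
  refine Filter.mem_of_superset (Metric.ball_mem_nhds u hr) ?_
  intro f₁ hf₁
  by_contra hf₁F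
  set d := f₁ - w with hd
  have hd0 : d ≠ 0 := by
    intro h
    rw [hd, sub_eq_zero] at h
    exact hf₁F (h ▸ interior_subset hwW)
  obtain ⟨n, hn⟩ : ∃ n, Module.finrank ℝ E = n + 1 := by
    apply Nat.exists_eq_succ_of_ne_zero
    intro h0
    have := Module.finrank_zero_iff.1 h0
    exact hd0 (Subsingleton.elim _ _)
  obtain ⟨π, hπs, hπ⟩ := exists_continuousLinearMap_ker_eq_span hn hd0
  let Z : Set V := {v | F v ∈ U ∧ 2 ≤ Module.finrank ℝ (fderiv ℝ F v).ker}
  let e : E ≃L[ℝ] V := (LinearEquiv.ofFinrankEq E V hVE.symm).toContinuousLinearEquiv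
  let J : V → ℝ := fun v => ((e : E →L[ℝ] V).comp (fderiv ℝ F v)).det
  have hJan : AnalyticOnNhd ℝ J univ := by
    intro v _
    have h1 : AnalyticAt ℝ (fun v => (e : E →L[ℝ] V).comp (fderiv ℝ F v)) v :=
      ((ContinuousLinearMap.compL ℝ V E V (e : E →L[ℝ] V)).analyticAt _).comp
        (hF v (mem_univ _)).fderiv
    let b := Module.finBasis ℝ V
    have h2 : ∀ T : V →L[ℝ] V, T.det = (LinearMap.toMatrix b b T.toLinearMap).det :=
      fun T => (LinearMap.det_toMatrix b _).symm
    simp only [J, h2, Matrix.det_apply']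
    refine Finset.analyticAt_fun_sum _ fun σ _ => ?_
    refine analyticAt_const.mul (Finset.analyticAt_fun_prod _ fun i _ => ?_)
    let ℓ : (V →L[ℝ] V) →ₗ[ℝ] ℝ :=
      { toFun := fun T => LinearMap.toMatrix b b T.toLinearMap (σ i) i
        map_add' := fun T T' => by simp [LinearMap.toMatrix_apply]
        map_smul' := fun c T => by simp [LinearMap.toMatrix_apply] }
    exact (ℓ.toContinuousLinearMap.analyticAt _).comp h1
  have hJ : ∀ v, J v ≠ 0 ↔ (fderiv ℝ F v).ker = ⊥ := by
    intro v
    rw [← isUnit_iff_ne_zero]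
    have : IsUnit (J v) ↔ Function.Bijective ((e : E →L[ℝ] V).comp (fderiv ℝ F v)) := by
      rw [← LinearMap.isUnit_iff_isUnit_det ((e : E →L[ℝ] V).comp (fderiv ℝ F v)).toLinearMap,
        Module.End.isUnit_iff]
      rfl
    rw [this]
    have h3 : Function.Injective ((e : E →L[ℝ] V).comp (fderiv ℝ F v)) ↔
        Function.Injective (fderiv ℝ F v) := e.injective.of_comp_iff _
    rw [LinearMap.ker_eq_bot]
    refine ⟨fun h => h3.1 h.1, fun h => ⟨h3.2 h, ?_⟩⟩
    exact (LinearMap.injective_iff_surjective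
      (f := ((e : E →L[ℝ] V).comp (fderiv ℝ F v)).toLinearMap)).1 (h3.2 h)
  have hFc : ContDiff ℝ 1 F := contDiff_iff_contDiffAt.2 fun v => (hF v (mem_univ _)).contDiffAt
  have hnull : volume ((π ∘ F) '' Z) = 0 := by
    refine volume_image_eq_zero_of_analytic_eq_zero (hVE.trans hn) (π.contDiff.comp hFc) hJan
      ((hJ v₀).2 hreg) (fun v hv => ?_) (fun v hv => ?_)
    · by_contra h
      have h2 := hv.2
      rw [(hJ v).1 h, finrank_bot] at h2
      omega
    · refine hv.2.trans (Submodule.finrank_mono ?_)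
      rw [fderiv_comp v π.differentiableAt (hFc.differentiable (by norm_num) v),
        ContinuousLinearMap.fderiv]
      intro x hx
      rw [LinearMap.mem_ker] at hx ⊢
      simp only [ContinuousLinearMap.coe_coe] at hx
      simp [hx]
  -- the projection of a neighbourhood of `w` lies in this null set
  have hnhds : ∀ᶠ w' in 𝓝 w, π w' ∈ (π ∘ F) '' Z := by
    have hA : ∀ᶠ w' in 𝓝 w, w' ∈ interior (range F) := isOpen_interior.mem_nhds hwW
    have hB : ∀ᶠ w' in 𝓝 w, w' ∈ Metric.ball u r :=
      Metric.isOpen_ball.mem_nhds (by rwa [Metric.mem_ball, dist_comm])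
    have hcont : Filter.Tendsto (fun w' => w' + d) (𝓝 w) (𝓝 f₁) := by
      have : f₁ = w + d := by simp [hd]
      rw [this]
      exact (continuous_id.add continuous_const).tendsto w
    have hC : ∀ᶠ w' in 𝓝 w, w' + d ∈ Metric.ball u r ∩ (range F)ᶜ :=
      hcont.eventually ((Metric.isOpen_ball.inter hcl.isOpen_compl).mem_nhds ⟨hf₁, hf₁F⟩)
    filter_upwards [hA, hB, hC] with w' hA hB hC
    let s : Set ℝ := {t | t ∈ Icc (0 : ℝ) 1 ∧ w' + t • d ∈ range F}
    have hs : IsCompact s := by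
      refine isCompact_Icc.inter_right (hcl.preimage ?_)
      fun_prop
    have hsne : s.Nonempty := ⟨0, by simp, by simpa using interior_subset hA⟩
    obtain ⟨t, ⟨ht, hr⟩, hmax⟩ := hs.exists_isGreatest hsne
    have ht1 : t < 1 := by
      refine lt_of_le_of_ne ht.2 ?_
      rintro rfl
      exact hC.2 (by simpa using hr)
    have hmemU : w' + t • d ∈ U := by
      apply hball
      have := (convex_ball u r) hB hC.1 (sub_nonneg.2 ht.2) ht.1 (by ring)
      convert this using 1
      module
    have hnint : w' + t • d ∉ interior (range F) := by
      intro hin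
      have hc : Continuous fun t : ℝ => w' + t • d := by fun_prop
      have h1 : ∀ᶠ t' in 𝓝[>] t, w' + t' • d ∈ range F :=
        (hc.continuousAt.eventually (mem_interior_iff_mem_nhds.1 hin)).filter_mono
          nhdsWithin_le_nhds
      have h2 : ∀ᶠ t' in 𝓝[>] t, t' ∈ Ioo t 1 := Ioo_mem_nhdsGT ht1
      obtain ⟨t', ht'1, ht'2⟩ := (h1.and h2).exists
      have := hmax ⟨⟨ht.1.trans ht'2.1.le, ht'2.2.le⟩, ht'1⟩
      exact absurd ht'2.1 (not_lt.2 this)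
    obtain ⟨v, hv⟩ := hr
    refine ⟨v, ⟨hv ▸ hmemU, ?_⟩, ?_⟩
    · rcases hker v (hv ▸ hmemU) with h | h
      · exact absurd (hv ▸ hmem_interior v h) hnint
      · exact h
    · have : π d = 0 := (hπ d).2 ⟨1, by simp⟩
      simp [hv, this]
  have hopen : IsOpenMap π := π.isOpenMap hπs
  have himg : (π ∘ F) '' Z ∈ 𝓝 (π w) :=
    Filter.mem_of_superset (hopen.image_mem_nhds hnhds) (by rintro _ ⟨x, hx, rfl⟩; exact hx)
  exact absurd hnull (MeasureTheory.Measure.measure_pos_of_mem_nhds volume himg).ne'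

end Sard

section Pencil

theorem MvPolynomial.IsHomogeneous.eval_mul_const {σ R : Type*} [CommSemiring R]
    {φ : MvPolynomial σ R} {d : ℕ} (hφ : φ.IsHomogeneous d) (y : R) (w : σ → R) :
    MvPolynomial.eval (fun i => y * w i) φ = y ^ d * MvPolynomial.eval w φ := by
  rw [MvPolynomial.eval_eq, MvPolynomial.eval_eq, Finset.mul_sum]
  refine Finset.sum_congr rfl fun s hs => ?_
  have hd : ∑ i ∈ s.support, s i = d := by
    have := hφ (MvPolynomial.mem_support_iff.1 hs)
    simpa [Finsupp.weight_apply, Finsupp.sum] using this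
  simp only [mul_pow, Finset.prod_mul_distrib, Finset.prod_pow_eq_pow_sum, hd]
  ring

/-- Restriction of a homogeneous polynomial to a pencil, with coefficients depending
polynomially on the two generators of the pencil. -/
theorem exists_eval_pencil_of_isHomogeneous {σ : Type*} {φ : MvPolynomial σ ℝ}
    {d : ℕ} (hφ : φ.IsHomogeneous d) :
    ∃ c : Fin (d + 1) → MvPolynomial (σ ⊕ σ) ℝ, ∀ (a b : σ → ℝ) (y z : ℝ),
      MvPolynomial.eval (fun i => y * a i + z * b i) φ =
        ∑ j, MvPolynomial.eval (Sum.elim a b) (c j) * (y ^ (d - j) * z ^ (j : ℕ)) := by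
  let g : σ → (MvPolynomial (σ ⊕ σ) ℝ)[X] := fun i =>
    C (MvPolynomial.X (Sum.inl i)) + X * C (MvPolynomial.X (Sum.inr i))
  let Q : (MvPolynomial (σ ⊕ σ) ℝ)[X] :=
    MvPolynomial.aeval g (MvPolynomial.map (MvPolynomial.C (R := ℝ) (σ := σ ⊕ σ)) φ)
  have hdeg : Q.natDegree < d + 1 := by
    have h1 : Q.natDegree ≤ d * 1 := by
      refine MvPolynomial.aeval_natDegree_le _
        (hφ.map _).totalDegree_le _ fun i => ?_
      refine (natDegree_add_le _ _).trans (max_le ((natDegree_C _).trans_le zero_le_one) ?_)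
      refine natDegree_mul_le.trans ?_
      rw [natDegree_C, natDegree_X]
    omega
  refine ⟨fun j => Q.coeff j, fun a b y z => ?_⟩
  have hQ : ∀ z : ℝ, MvPolynomial.eval (fun i => a i + z * b i) φ =
      ∑ j : Fin (d + 1), MvPolynomial.eval (Sum.elim a b) (Q.coeff j) * z ^ (j : ℕ) := by
    intro z
    let ψ : (MvPolynomial (σ ⊕ σ) ℝ)[X] →+* ℝ :=
      Polynomial.eval₂RingHom (MvPolynomial.eval (Sum.elim a b)) z
    have h1 : ψ Q = MvPolynomial.eval (fun i => a i + z * b i) φ := by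
      have h : (ψ.comp (MvPolynomial.aeval g).toRingHom).comp
          (MvPolynomial.map (MvPolynomial.C (R := ℝ) (σ := σ ⊕ σ))) =
          MvPolynomial.eval (fun i => a i + z * b i) := by
        refine MvPolynomial.ringHom_ext (fun r => ?_) (fun i => ?_)
        · simp [ψ]
        · simp [ψ, g, mul_comm (b i) z]
      exact DFunLike.congr_fun h φ
    have h2 : ψ Q = eval z (Q.map (MvPolynomial.eval (Sum.elim a b))) := eval₂_eq_eval_map _
    rw [← h1]
    rw [h2, eval_eq_sum_range' (lt_of_le_of_lt natDegree_map_le hdeg), Finset.sum_range]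
    simp
  have key : (fun y => MvPolynomial.eval (fun i => y * a i + z * b i) φ) = fun y =>
      ∑ j : Fin (d + 1), MvPolynomial.eval (Sum.elim a b) (Q.coeff j) *
        (y ^ (d - j) * z ^ (j : ℕ)) := by
    refine Continuous.ext_on (dense_compl_singleton (0 : ℝ)) ?_ (by fun_prop) ?_
    · exact (MvPolynomial.continuous_eval φ).comp (by fun_prop)
    · intro y hy
      have hy : y ≠ 0 := hy
      have h3 : (fun i => y * a i + z * b i) = fun i => y * (a i + z / y * b i) := by
        funext i; field_simp
      simp only [h3, hφ.eval_mul_const, hQ, Finset.mul_sum]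
      refine Finset.sum_congr rfl fun j _ => ?_
      have h4 : y ^ d = y ^ (d - j) * y ^ (j : ℕ) := by
        rw [← pow_add, Nat.sub_add_cancel (Nat.lt_succ_iff.1 j.2)]
      rw [h4, div_pow]
      field_simp
  exact congrFun key y

/-- Coefficients of monic ternary forms of degree `m`. -/
abbrev TernaryCoeff (m : ℕ) : Type := (Σ k : Fin m, Fin (m - k + 1)) → ℝ

/-- The non-leading part of a ternary form, as a polynomial in its distinguished variable. -/
noncomputable def ternaryTail {m : ℕ} (e : TernaryCoeff m) (y z : ℝ) : ℝ[X] :=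
  ∑ i, C (e i * (y ^ (m - i.1 - i.2) * z ^ (i.2 : ℕ))) * X ^ (i.1 : ℕ)

/-- The monic ternary form with given coefficients. -/
noncomputable def ternary {m : ℕ} (e : TernaryCoeff m) (y z : ℝ) : ℝ[X] :=
  X ^ m + ternaryTail e y z

theorem coeff_ternaryTail {m : ℕ} (e : TernaryCoeff m) (y z : ℝ) (k : Fin m) :
    (ternaryTail e y z).coeff k =
      ∑ j : Fin (m - k + 1), e ⟨k, j⟩ * (y ^ (m - k - j) * z ^ (j : ℕ)) := by
  rw [ternaryTail, finsetSum_coeff, Fintype.sum_sigma, Finset.sum_eq_single k]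
  · refine Finset.sum_congr rfl fun j _ => ?_
    rw [coeff_C_mul, coeff_X_pow_self, mul_one]
  · intro l _ hl
    refine Finset.sum_eq_zero fun j _ => ?_
    rw [coeff_C_mul, coeff_X_pow, if_neg (fun h => hl (Fin.ext h.symm)), mul_zero]
  · simp

theorem degree_ternaryTail_lt {m : ℕ} (e : TernaryCoeff m) (y z : ℝ) :
    (ternaryTail e y z).degree < m := by
  refine (degree_sum_le _ _).trans_lt ((Finset.sup_lt_iff (WithBot.bot_lt_coe m)).2 ?_)
  intro i _
  exact (degree_C_mul_X_pow_le _ _).trans_lt (WithBot.coe_lt_coe.2 i.1.2)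

theorem monic_ternary {m : ℕ} (e : TernaryCoeff m) (y z : ℝ) : (ternary e y z).Monic :=
  monic_X_pow_add (degree_ternaryTail_lt e y z)

theorem natDegree_ternary {m : ℕ} (e : TernaryCoeff m) (y z : ℝ) :
    (ternary e y z).natDegree = m := by
  rw [ternary, natDegree_add_eq_left_of_degree_lt, natDegree_X_pow]
  rw [degree_X_pow]; exact degree_ternaryTail_lt e y z

theorem ternaryTail_add {m : ℕ} (e e' : TernaryCoeff m) (y z : ℝ) :
    ternaryTail (e + e') y z = ternaryTail e y z + ternaryTail e' y z := by
  simp [ternaryTail, add_mul, Finset.sum_add_distrib]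

theorem ternaryTail_smul {m : ℕ} (t : ℝ) (e : TernaryCoeff m) (y z : ℝ) :
    ternaryTail (t • e) y z = C t * ternaryTail e y z := by
  simp [ternaryTail, Finset.mul_sum, mul_assoc]

theorem eq_zero_of_ternaryTail_eq_zero {m : ℕ} {e : TernaryCoeff m}
    (h : ∀ z, ternaryTail e 1 z = 0) : e = 0 := by
  funext ⟨k, j⟩
  have h1 : (∑ j : Fin (m - k + 1), C (e ⟨k, j⟩) * X ^ (j : ℕ) : ℝ[X]) = 0 := by
    refine Polynomial.funext fun z => ?_
    have := coeff_ternaryTail e 1 z k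
    rw [h, coeff_zero] at this
    simpa [eval_finsetSum] using this.symm
  have h2 := congrArg (fun p => p.coeff j) h1
  simp only [finsetSum_coeff, coeff_zero] at h2
  rw [Finset.sum_eq_single j] at h2
  · simpa using h2
  · intro l _ hl
    rw [coeff_C_mul, coeff_X_pow, if_neg (fun h => hl (Fin.ext h.symm)), mul_zero]
  · simp

theorem ternary_injective {m : ℕ} {e e' : TernaryCoeff m}
    (h : ∀ z, ternary e 1 z = ternary e' 1 z) : e = e' := by
  rw [← sub_eq_zero]
  apply eq_zero_of_ternaryTail_eq_zero
  intro z
  have h1 : ternaryTail e 1 z = ternaryTail e' 1 z := add_left_cancel (h z)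
  rw [sub_eq_add_neg, ternaryTail_add, ← neg_one_smul ℝ e', ternaryTail_smul, h1]
  simp

theorem eq_ternary_of_coeff {m : ℕ} {e : TernaryCoeff m} {y z : ℝ} {p : ℝ[X]} (hp : p.Monic)
    (hd : p.natDegree = m) (h : ∀ k : Fin m, p.coeff k =
      ∑ j : Fin (m - k + 1), e ⟨k, j⟩ * (y ^ (m - k - j) * z ^ (j : ℕ))) :
    ternary e y z = p := by
  ext k
  rcases lt_trichotomy k m with hk | rfl | hk
  · rw [ternary, coeff_add, coeff_X_pow, if_neg hk.ne, zero_add]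
    exact (coeff_ternaryTail e y z ⟨k, hk⟩).trans (h ⟨k, hk⟩).symm
  · have := (monic_ternary e y z).coeff_natDegree
    rw [natDegree_ternary] at this
    rw [this, ← hp.coeff_natDegree, hd]
  · rw [coeff_eq_zero_of_natDegree_lt, coeff_eq_zero_of_natDegree_lt]
    · omega
    · rw [natDegree_ternary]; omega

/-- Pairs of a diagonal and a symmetric matrix. -/
abbrev DiagSym (m : ℕ) : Type := (Fin m → ℝ) × (Sym2 (Fin m) → ℝ)

/-- The symmetric matrix with given entries. -/
def symMatrix {m : ℕ} (b : Sym2 (Fin m) → ℝ) : Matrix (Fin m) (Fin m) ℝ :=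
  Matrix.of fun i j => b s(i, j)

theorem isSymm_symMatrix {m : ℕ} (b : Sym2 (Fin m) → ℝ) : (symMatrix b).IsSymm := by
  ext i j; simp [symMatrix, Sym2.eq_swap]

theorem exists_eq_symMatrix {m : ℕ} {B : Matrix (Fin m) (Fin m) ℝ} (hB : B.IsSymm) :
    ∃ b, symMatrix b = B :=
  ⟨Sym2.lift ⟨fun i j => B i j, fun i j => (hB.apply i j).symm⟩, by ext i j; simp [symMatrix]⟩

theorem finrank_diagSym (m : ℕ) :
    Module.finrank ℝ (DiagSym m) = Module.finrank ℝ (TernaryCoeff m) := by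
  rw [Module.finrank_prod, Module.finrank_pi, Module.finrank_pi, Module.finrank_pi,
    Fintype.card_sigma, Sym2.card]
  simp only [Fintype.card_fin]
  have h1 : ∑ k : Fin m, (m - k + 1) = ∑ k ∈ Finset.range m, (k + 2) := by
    rw [← Finset.sum_range_reflect, Finset.sum_range]
    refine Finset.sum_congr rfl fun k _ => ?_
    have := k.2
    omega
  rw [h1, Finset.sum_add_distrib, Finset.sum_range_id]
  have h2 : (m + 1).choose 2 = m * (m - 1) / 2 + m := by
    rw [Nat.choose_succ_succ' m 1, Nat.choose_one_right, Nat.choose_two_right]; ring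
  rw [h2]
  simp; ring

/-- The coefficients of the determinantal form of a pair, as an analytic map. -/
theorem exists_analytic_ternary_eq_charpoly (m : ℕ) :
    ∃ F : DiagSym m → TernaryCoeff m, AnalyticOnNhd ℝ F Set.univ ∧ ∀ v y z,
      ternary (F v) y z = (y • diagonal v.1 + z • symMatrix v.2).charpoly := by
  have hhom : ∀ k : Fin m, ((charpoly.univ ℝ (Fin m)).coeff k).IsHomogeneous (m - k) := fun k =>
    charpoly.univ_coeff_isHomogeneous ℝ (Fin m) k (m - k)
      (by rw [Fintype.card_fin]; exact Nat.add_sub_of_le k.2.le)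
  choose c hc using fun k => exists_eval_pencil_of_isHomogeneous (hhom k)
  let w : DiagSym m → (Fin m × Fin m) ⊕ (Fin m × Fin m) → ℝ := fun v =>
    Sum.elim (fun p => diagonal v.1 p.1 p.2) (fun p => symMatrix v.2 p.1 p.2)
  refine ⟨fun v i => MvPolynomial.eval (w v) (c i.1 i.2), ?_, fun v y z => ?_⟩
  · rw [AnalyticOnNhd]
    intro v _
    rw [analyticAt_pi_iff]
    intro i
    have := AnalyticAt.aeval_mvPolynomial (𝕜 := ℝ) (z := v) (f := w) (A := ℝ) (fun s => ?_)
      (c i.1 i.2)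
    · simpa [MvPolynomial.aeval_eq_eval] using this
    · rcases s with ⟨i, j⟩ | ⟨i, j⟩
      · by_cases h : i = j
        · subst h
          simp only [w, Sum.elim_inl, diagonal_apply_eq]
          exact ((ContinuousLinearMap.proj i).comp (ContinuousLinearMap.fst ℝ (Fin m → ℝ)
            (Sym2 (Fin m) → ℝ))).analyticAt v
        · simp only [w, Sum.elim_inl, diagonal_apply_ne _ h]
          exact analyticAt_const
      · exact ((ContinuousLinearMap.proj s(i, j)).comp (ContinuousLinearMap.snd ℝ (Fin m → ℝ)
            (Sym2 (Fin m) → ℝ))).analyticAt v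
  · refine eq_ternary_of_coeff (charpoly_monic _) (by simp [charpoly_natDegree_eq_dim]) fun k => ?_
    rw [← hc k]
    have := charpoly.univ_coeff_eval₂Hom (n := Fin m) (RingHom.id ℝ)
      (fun p => y * diagonal v.1 p.1 p.2 + z * symMatrix v.2 p.1 p.2) k
    rw [MvPolynomial.coe_eval₂Hom, MvPolynomial.eval₂_id] at this
    rw [this]
    rfl

/-- Jacobi's formula. -/
theorem hasDerivAt_det_add_smul {n : Type*} [Fintype n] [DecidableEq n] (N P : Matrix n n ℝ) :
    HasDerivAt (fun ε : ℝ => (N + ε • P).det) (trace (adjugate N * P)) 0 := by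
  let Φ : ContinuousMultilinearMap ℝ (fun _ : n => n → ℝ) ℝ :=
    { (detRowAlternating : (n → ℝ) [⋀^n]→ₗ[ℝ] ℝ).toMultilinearMap with
      cont := by
        change Continuous fun M : Matrix n n ℝ => M.det
        exact Continuous.matrix_det continuous_id }
  have h1 : HasDerivAt (fun ε : ℝ => (fun i => N i + ε • P i : n → n → ℝ)) (fun i => P i) 0 := by
    rw [hasDerivAt_pi]
    intro i
    simpa using ((hasDerivAt_id (0 : ℝ)).smul_const (P i)).const_add (N i)
  have h2 := (Φ.hasFDerivAt (x := fun i => N i + (0 : ℝ) • P i)).comp_hasDerivAt 0 h1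
  refine HasDerivAt.congr_deriv h2 ?_
  rw [ContinuousMultilinearMap.linearDeriv_apply]
  simp only [zero_smul, add_zero, trace, diag_apply]
  have h3 : ∀ i, Φ (Function.update (fun i => N i) i (P i)) = (P * adjugate N) i i := by
    intro i
    change (N.updateRow i (P i)).det = _
    rw [← cramer_transpose_apply, cramer_eq_adjugate_mulVec, ← adjugate_transpose,
      mulVec_transpose]
    rfl
  simp only [h3]
  exact trace_mul_comm _ _

theorem eval_ternaryTail_fderiv {m : ℕ} {F : DiagSym m → TernaryCoeff m}
    (hF : Differentiable ℝ F)
    (hch : ∀ v y z, ternary (F v) y z = (y • diagonal v.1 + z • symMatrix v.2).charpoly)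
    (v δ : DiagSym m) (x y z : ℝ) :
    (ternaryTail (fderiv ℝ F v δ) y z).eval x =
      -trace (adjugate (scalar (Fin m) x - (y • diagonal v.1 + z • symMatrix v.2)) *
        (y • diagonal δ.1 + z • symMatrix δ.2)) := by
  let ℓ : TernaryCoeff m →ₗ[ℝ] ℝ :=
    { toFun := fun e => (ternaryTail e y z).eval x
      map_add' := fun e e' => by rw [ternaryTail_add, eval_add]
      map_smul' := fun t e => by rw [ternaryTail_smul, eval_mul, eval_C]; rfl }
  have h1 : HasDerivAt (fun ε : ℝ => v + ε • δ) δ 0 := by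
    simpa using ((hasDerivAt_id (0 : ℝ)).smul_const δ).const_add v
  have h2 : HasFDerivAt F (fderiv ℝ F v) (v + (0 : ℝ) • δ) := by
    simpa using (hF v).hasFDerivAt
  have h3 := ((ℓ.toContinuousLinearMap.hasFDerivAt).comp_hasDerivAt 0
    (h2.comp_hasDerivAt 0 h1)).const_add (x ^ m)
  have h4 := hasDerivAt_det_add_smul
    (scalar (Fin m) x - (y • diagonal v.1 + z • symMatrix v.2))
    (-(y • diagonal δ.1 + z • symMatrix δ.2))
  have h5 : (fun ε : ℝ => x ^ m + (ℓ.toContinuousLinearMap ∘ F ∘ fun ε : ℝ => v + ε • δ) ε) =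
      fun ε : ℝ => (scalar (Fin m) x - (y • diagonal v.1 + z • symMatrix v.2) +
        ε • -(y • diagonal δ.1 + z • symMatrix δ.2)).det := by
    funext ε
    have := congrArg (eval x) (hch (v + ε • δ) y z)
    rw [eval_charpoly, ternary, eval_add, eval_pow, eval_X] at this
    refine this.trans ?_
    congr 1
    ext i j
    by_cases h : i = j
    · subst h; simp [symMatrix]; ring
    · simp [symMatrix, diagonal_apply_ne _ h]; ring
  rw [h5] at h3
  have := h3.unique h4
  rw [mul_neg, trace_neg] at this
  exact this

end Pencil

section CommutingSkew

/-- A vector in the range of infinitely many members of a pencil that is injective everywhere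
(including at infinity) vanishes. -/
theorem eq_zero_of_forall_mem_range_pencil {W W' : Type*} [AddCommGroup W] [Module ℂ W]
    [FiniteDimensional ℂ W] [AddCommGroup W'] [Module ℂ W'] {A B : W →ₗ[ℂ] W'}
    (hA : ∀ (z : ℂ) (k : W), A k + z • B k = 0 → k = 0) (hB : Function.Injective B)
    {Z : Set ℂ} (hZ : Z.Infinite) {δ : W'} (hδ : ∀ z ∈ Z, ∃ k, A k + z • B k = δ) : δ = 0 := by
  let S : Submodule ℂ W' := ⨅ z ∈ Z, LinearMap.range (A + z • B)
  have hS : ∀ x, x ∈ S ↔ ∀ z ∈ Z, ∃ k, A k + z • B k = x := by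
    intro x
    simp only [S, Submodule.mem_iInf, LinearMap.mem_range, LinearMap.add_apply,
      LinearMap.smul_apply]
  have hSB : ∀ x ∈ S, ∃ k, B k = x := by
    intro x hx
    by_contra! hne
    have hx0 : x ≠ 0 := fun h => hne 0 (by rw [h, map_zero])
    let T : W × ℂ →ₗ[ℂ] W' := B.coprod (LinearMap.toSpanSingleton ℂ W' x)
    have hT : LinearMap.ker T = ⊥ := by
      rw [LinearMap.ker_eq_bot']
      rintro ⟨k, c⟩ h
      simp only [T, LinearMap.coprod_apply, LinearMap.toSpanSingleton_apply] at h
      by_cases hc : c = 0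
      · subst hc
        rw [zero_smul, add_zero] at h
        rw [hB (h.trans (map_zero B).symm)]; rfl
      · refine absurd ?_ (hne (-c⁻¹ • k))
        rw [map_smul, eq_neg_of_add_eq_zero_left h, smul_neg, neg_smul, neg_neg, smul_smul,
          inv_mul_cancel₀ hc, one_smul]
    obtain ⟨g, hg⟩ := T.exists_leftInverse_of_injective hT
    let φ : W' →ₗ[ℂ] W := LinearMap.fst ℂ W ℂ ∘ₗ g
    have hφB : ∀ k, φ (B k) = k := by
      intro k
      have := LinearMap.congr_fun hg (k, 0)
      simp only [LinearMap.comp_apply, T, LinearMap.coprod_apply, map_zero, add_zero] at this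
      simp [φ, this]
    have hφx : φ x = 0 := by
      have := LinearMap.congr_fun hg (0, 1)
      simp only [LinearMap.comp_apply, T, LinearMap.coprod_apply, map_zero, zero_add,
        LinearMap.toSpanSingleton_apply, one_smul] at this
      simp [φ, this]
    refine (hZ.image (f := fun z => -z) neg_injective.injOn)
      ((Module.End.finite_hasEigenvalue (φ ∘ₗ A)).subset ?_)
    rintro _ ⟨z, hz, rfl⟩
    obtain ⟨k, hk⟩ := (hS x).1 hx z hz
    refine Module.End.hasEigenvalue_of_hasEigenvector (x := k) ⟨?_, ?_⟩
    · rw [Module.End.mem_eigenspace_iff, LinearMap.comp_apply, eq_sub_of_add_eq hk, map_sub,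
        map_smul, hφB, hφx, zero_sub, neg_smul]
    · rintro rfl
      apply hx0
      rw [← hk]; simp
  have hSA : ∀ k, B k ∈ S → A k ∈ S := by
    intro k hk
    rw [hS] at hk ⊢
    intro z hz
    obtain ⟨l, hl⟩ := hk z hz
    refine ⟨k - z • l, ?_⟩
    rw [map_sub, map_sub, map_smul, map_smul, ← hl]
    rw [eq_sub_of_add_eq hl]
    module
  by_contra hδ0
  obtain ⟨k₀, hk₀⟩ := hSB δ ((hS δ).2 hδ)
  let W₀ : Submodule ℂ W := S.comap B
  have hk₀W : k₀ ∈ W₀ := by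
    rw [Submodule.mem_comap, hk₀]; exact (hS δ).2 hδ
  obtain ⟨L, hL⟩ := B.exists_leftInverse_of_injective (LinearMap.ker_eq_bot.2 hB)
  have hLB : ∀ k, L (B k) = k := fun k => LinearMap.congr_fun hL k
  have hBL : ∀ x ∈ S, B (L x) = x := by
    intro x hx
    obtain ⟨k, rfl⟩ := hSB x hx
    rw [hLB]
  let f : W₀ →ₗ[ℂ] W₀ := (L ∘ₗ A).restrict (p := W₀) (q := W₀) fun k hk => by
    change B (L (A k)) ∈ S
    rw [hBL _ (hSA k hk)]
    exact hSA k hk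
  have : Nontrivial W₀ := ⟨⟨⟨k₀, hk₀W⟩, 0, fun h => hδ0 (by
    rw [← hk₀, show k₀ = 0 from congrArg Subtype.val h, map_zero])⟩⟩
  obtain ⟨μ, hμ⟩ := Module.End.exists_eigenvalue f
  obtain ⟨k, hk⟩ := hμ.exists_hasEigenvector
  have h1 : L (A k) = μ • (k : W) := congrArg Subtype.val hk.apply_eq_smul
  have h2 : A k = μ • B k := by
    rw [← hBL _ (hSA k k.2), h1, map_smul]
  refine hk.2 (Subtype.ext (hA (-μ) k ?_))
  rw [h2]; module

variable {n : Type*} [Fintype n] [DecidableEq n]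

theorem Matrix.IsSymm.exists_spectral {M : Matrix n n ℝ} (hM : M.IsSymm) :
    ∃ (O : Matrix n n ℝ) (r : n → ℝ), O * Oᵀ = 1 ∧ Oᵀ * O = 1 ∧ M = O * diagonal r * Oᵀ ∧
      M.charpoly = ∏ i, (X - C (r i)) := by
  have hH : M.IsHermitian := by
    rw [Matrix.IsHermitian, conjTranspose_eq_transpose_of_trivial]; exact hM
  refine ⟨hH.eigenvectorUnitary, hH.eigenvalues, ?_, ?_, ?_, ?_⟩
  · rw [← conjTranspose_eq_transpose_of_trivial, ← star_eq_conjTranspose]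
    exact Unitary.coe_mul_star_self _
  · rw [← conjTranspose_eq_transpose_of_trivial, ← star_eq_conjTranspose]
    exact Unitary.coe_star_mul_self _
  · conv_lhs => rw [hH.spectral_theorem]
    rw [Unitary.conjStarAlgAut_apply, star_eq_conjTranspose,
      conjTranspose_eq_transpose_of_trivial]
    rfl
  · simpa using hH.charpoly_eq

theorem trace_adjugate_conj {O : Matrix n n ℝ} (hO : O * Oᵀ = 1) (N P : Matrix n n ℝ) :
    trace (adjugate (O * N * Oᵀ) * P) = trace (adjugate N * (Oᵀ * P * O)) := by
  have hO' : Oᵀ * O = 1 := mul_eq_one_comm.1 hO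
  have h1 := hasDerivAt_det_add_smul (O * N * Oᵀ) P
  have h2 := hasDerivAt_det_add_smul N (Oᵀ * P * O)
  refine h1.unique (h2.congr_of_eventuallyEq (Filter.Eventually.of_forall fun ε => ?_))
  have h3 : O * N * Oᵀ + ε • P = O * (N + ε • (Oᵀ * P * O)) * Oᵀ := by
    have : O * (Oᵀ * P * O) * Oᵀ = P := by
      rw [show O * (Oᵀ * P * O) * Oᵀ = (O * Oᵀ) * P * (O * Oᵀ) by simp only [Matrix.mul_assoc],
        hO, Matrix.one_mul, Matrix.mul_one]
    rw [Matrix.mul_add, Matrix.add_mul, Matrix.mul_smul, Matrix.smul_mul, this]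
  simp only
  rw [h3, det_mul_right_comm, hO, Matrix.one_mul]

/-- A symmetric first-order perturbation of a symmetric matrix with simple spectrum that does not
move the spectrum is an infinitesimal rotation. -/
theorem exists_skew_of_trace_adjugate_eq_zero {M P : Matrix n n ℝ} (hM : M.IsSymm)
    (hs : M.charpoly.Separable) (hP : P.IsSymm)
    (h : ∀ x : ℝ, trace (adjugate (scalar n x - M) * P) = 0) :
    ∃ K : Matrix n n ℝ, Kᵀ = -K ∧ M * K - K * M = P := by
  obtain ⟨O, r, hO, hO', hMO, hch⟩ := hM.exists_spectral
  rw [hch, separable_prod_X_sub_C_iff] at hs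
  set P' := Oᵀ * P * O with hP'
  have hP's : P'.IsSymm := by
    rw [Matrix.IsSymm, hP', transpose_mul, transpose_mul, transpose_transpose, hP.eq,
      Matrix.mul_assoc]
  have hPO : O * P' * Oᵀ = P := by
    rw [hP', show O * (Oᵀ * P * O) * Oᵀ = (O * Oᵀ) * P * (O * Oᵀ) by
      simp only [Matrix.mul_assoc], hO, Matrix.one_mul, Matrix.mul_one]
  have hdiag : ∀ i, P' i i = 0 := by
    intro i
    have h1 := h (r i)
    have h2 : scalar n (r i) - M = O * diagonal (fun j => r i - r j) * Oᵀ := by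
      have : diagonal (fun j => r i - r j) = scalar n (r i) - diagonal r := by
        rw [scalar_apply, diagonal_sub]
      rw [this, Matrix.mul_sub, Matrix.sub_mul, ← hMO, (scalar_commute (r i)
        (fun _ => Commute.all _ _) O).symm.eq, Matrix.mul_assoc, hO, Matrix.mul_one]
    rw [h2, trace_adjugate_conj hO, adjugate_diagonal, trace] at h1
    simp only [diag_apply, diagonal_mul] at h1
    rw [Finset.sum_eq_single i] at h1
    · refine (mul_eq_zero.1 h1).resolve_left (Finset.prod_ne_zero_iff.2 fun j hj => ?_)
      exact sub_ne_zero.2 fun he => Finset.ne_of_mem_erase hj (hs he).symm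
    · intro j _ hj
      rw [Finset.prod_eq_zero (Finset.mem_erase.2 ⟨hj.symm, Finset.mem_univ i⟩) (sub_self _),
        zero_mul]
    · simp
  let K' : Matrix n n ℝ := Matrix.of fun i j => P' i j / (r i - r j)
  have hK'1 : K'ᵀ = -K' := by
    ext i j
    simp only [K', transpose_apply, of_apply, Matrix.neg_apply]
    rw [hP's.apply i j, ← neg_sub (r i) (r j), div_neg]
  have hK'2 : diagonal r * K' - K' * diagonal r = P' := by
    ext i j
    rw [Matrix.sub_apply, diagonal_mul, mul_diagonal]
    simp only [K', of_apply]
    by_cases hij : i = j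
    · subst hij; rw [hdiag]; simp
    · have : r i - r j ≠ 0 := sub_ne_zero.2 fun he => hij (hs he)
      field_simp
  refine ⟨O * K' * Oᵀ, ?_, ?_⟩
  · rw [transpose_mul, transpose_mul, transpose_transpose, hK'1]
    simp [Matrix.mul_assoc]
  · conv_rhs => rw [← hPO, ← hK'2]
    rw [hMO, Matrix.mul_sub, Matrix.sub_mul]
    congr 1
    · rw [show O * diagonal r * Oᵀ * (O * K' * Oᵀ) = O * diagonal r * (Oᵀ * O) * K' * Oᵀ by
        simp only [Matrix.mul_assoc], hO', Matrix.mul_one]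
      simp only [Matrix.mul_assoc]
    · rw [show O * K' * Oᵀ * (O * diagonal r * Oᵀ) = O * K' * (Oᵀ * O) * diagonal r * Oᵀ by
        simp only [Matrix.mul_assoc], hO', Matrix.mul_one]
      simp only [Matrix.mul_assoc]

/-- The complexification of a real matrix. -/
noncomputable def complexify {n : Type*} (M : Matrix n n ℝ) : Matrix n n ℂ := M.map (algebraMap ℝ ℂ)

theorem eq_zero_of_skew_of_commute {M : Matrix n n ℝ} (hM : M.IsSymm)
    (hs : M.charpoly.Separable) {K : Matrix n n ℂ} (hK : Kᵀ = -K)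
    (hc : complexify M * K - K * complexify M = 0) : K = 0 := by
  obtain ⟨O, r, hO, hO', hMO, hch⟩ := hM.exists_spectral
  rw [hch, separable_prod_X_sub_C_iff] at hs
  set Q := complexify O with hQ
  set Λ : Matrix n n ℂ := diagonal fun i => (r i : ℂ) with hΛ
  have hQQ : Q * Qᵀ = 1 := by
    rw [hQ, complexify, ← transpose_map, ← Matrix.map_mul, hO, Matrix.map_one _ (by simp) (by simp)]
  have hQQ' : Qᵀ * Q = 1 := mul_eq_one_comm.1 hQQ
  have hMQ : complexify M = Q * Λ * Qᵀ := by
    rw [hMO, hQ, complexify, complexify, ← transpose_map, Matrix.map_mul, Matrix.map_mul,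
      diagonal_map (by simp)]
    rfl
  set K' := Qᵀ * K * Q with hK'
  have hK's : K'ᵀ = -K' := by
    rw [hK', transpose_mul, transpose_mul, transpose_transpose, hK]; simp [Matrix.mul_assoc]
  have hcomm : Λ * K' - K' * Λ = 0 := by
    have h1 : Qᵀ * (complexify M * K - K * complexify M) * Q = 0 := by rw [hc]; simp
    rw [Matrix.mul_sub, Matrix.sub_mul, hMQ] at h1
    rw [← h1, hK']
    congr 1
    · rw [show Qᵀ * (Q * Λ * Qᵀ * K) * Q = (Qᵀ * Q) * Λ * (Qᵀ * K * Q) by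
        simp only [Matrix.mul_assoc], hQQ', Matrix.one_mul]
    · rw [show Qᵀ * (K * (Q * Λ * Qᵀ)) * Q = Qᵀ * K * Q * Λ * (Qᵀ * Q) by
        simp only [Matrix.mul_assoc], hQQ', Matrix.mul_one]
  have hK'0 : K' = 0 := by
    ext i j
    by_cases hij : i = j
    · subst hij
      have := congrFun (congrFun hK's i) i
      rw [transpose_apply, Matrix.neg_apply] at this
      exact self_eq_neg.1 this
    · have := congrFun (congrFun hcomm i) j
      rw [Matrix.sub_apply, hΛ, diagonal_mul, mul_diagonal, Matrix.zero_apply, mul_comm (K' i j), ← sub_mul]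
        at this
      refine (mul_eq_zero.1 this).resolve_left (sub_ne_zero.2 fun h => hij (hs ?_))
      exact_mod_cast h
  rw [show K = (Q * Qᵀ) * K * (Q * Qᵀ) by rw [hQQ, Matrix.one_mul, Matrix.mul_one],
    show (Q * Qᵀ) * K * (Q * Qᵀ) = Q * (Qᵀ * K * Q) * Qᵀ by simp only [Matrix.mul_assoc],
    ← hK', hK'0]
  simp

end CommutingSkew

section Kernel

variable {n : Type*} [Fintype n] [DecidableEq n]

theorem complexify_smul_add_smul {n : Type*} (y z : ℝ) (D B : Matrix n n ℝ) :
    complexify (y • D + z • B) = (y : ℂ) • complexify D + (z : ℂ) • complexify B := by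
  ext i j; simp [complexify]

/-- No member of the complex pencil `D + z B` commutes with a nonzero skew-symmetric matrix. -/
def NoCommutingSkew (D B : Matrix n n ℝ) : Prop :=
  ∀ (z : ℂ) (K : Matrix n n ℂ), Kᵀ = -K →
    (complexify D * K - K * complexify D) + z • (complexify B * K - K * complexify B) = 0 → K = 0

/-- The space of complex skew-symmetric matrices. -/
def skewSubmodule (n : Type*) : Submodule ℂ (Matrix n n ℂ) where
  carrier := {K | Kᵀ = -K}
  add_mem' := fun {K L} hK hL => by
    rw [Set.mem_ofPred_eq] at *; rw [transpose_add, hK, hL, neg_add]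
  zero_mem' := by simp
  smul_mem' := fun c K hK => by
    rw [Set.mem_ofPred_eq] at *; rw [transpose_smul, hK, smul_neg]

/-- The commutator with a fixed matrix. -/
def commutatorMap (M : Matrix n n ℂ) : Matrix n n ℂ →ₗ[ℂ] Matrix n n ℂ :=
  LinearMap.mulLeft ℂ M - LinearMap.mulRight ℂ M

theorem commutatorMap_apply (M K : Matrix n n ℂ) : commutatorMap M K = M * K - K * M := by
  simp [commutatorMap]

theorem complexify_commutator {n : Type*} [Fintype n] (M K : Matrix n n ℝ) :
    complexify M * complexify K - complexify K * complexify M = complexify (M * K - K * M) := by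
  simp only [complexify, ← Matrix.map_mul]
  ext i j; simp

theorem complexify_injective {n : Type*} : Function.Injective (complexify (n := n)) := by
  intro M N h
  ext i j
  simpa [complexify] using congrFun (congrFun h i) j

theorem eq_zero_of_forall_exists_skew {D B δ : Matrix n n ℝ} (hB : B.IsSymm)
    (hBs : B.charpoly.Separable) (hno : NoCommutingSkew D B)
    (h : ∀ z : ℝ, z ≠ 0 → ∃ K : Matrix n n ℝ, Kᵀ = -K ∧
      (D + z • B) * K - K * (D + z • B) = δ) : δ = 0 := by
  have key : complexify δ = 0 := by
    refine eq_zero_of_forall_mem_range_pencil (W := skewSubmodule n)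
      (A := commutatorMap (complexify D) ∘ₗ (skewSubmodule n).subtype)
      (B := commutatorMap (complexify B) ∘ₗ (skewSubmodule n).subtype)
      (Z := (fun z : ℝ => (z : ℂ)) '' {z | z ≠ 0}) ?_ ?_ ?_ ?_
    · rintro z ⟨K, hK⟩ hz
      simp only [LinearMap.comp_apply, Submodule.subtype_apply, commutatorMap_apply] at hz
      exact Subtype.ext (hno z K hK hz)
    · rw [← LinearMap.ker_eq_bot, LinearMap.ker_eq_bot']
      rintro ⟨K, hK⟩ hz
      simp only [LinearMap.comp_apply, Submodule.subtype_apply, commutatorMap_apply] at hz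
      exact Subtype.ext (eq_zero_of_skew_of_commute hB hBs hK hz)
    · exact (Set.infinite_of_finite_compl (by simp)).image Complex.ofReal_injective.injOn
    · rintro _ ⟨z, hz, rfl⟩
      obtain ⟨K, hK, hKδ⟩ := h z hz
      refine ⟨⟨complexify K, ?_⟩, ?_⟩
      · change (complexify K)ᵀ = -complexify K
        rw [complexify, ← transpose_map, hK]; ext i j; simp
      · simp only [LinearMap.comp_apply, Submodule.subtype_apply, commutatorMap_apply]
        rw [complexify_commutator, complexify_commutator, ← hKδ]
        ext i j
        simp [complexify, Matrix.add_mul, Matrix.mul_add]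
        ring
  apply complexify_injective
  rw [key]
  ext i j; simp [complexify]

theorem trace_adjugate_mul_commutator {R : Type*} [CommRing R] (x : R) (M K : Matrix n n R) :
    trace (adjugate (scalar n x - M) * (M * K - K * M)) = 0 := by
  have h1 : adjugate (scalar n x - M) * M = M * adjugate (scalar n x - M) := by
    have h2 := (mul_adjugate (scalar n x - M)).trans (adjugate_mul (scalar n x - M)).symm
    rw [Matrix.sub_mul, Matrix.mul_sub, (scalar_commute x (fun _ => Commute.all _ _) _).eq] at h2
    exact (sub_right_inj.1 h2).symm
  rw [Matrix.mul_sub, trace_sub, ← Matrix.mul_assoc, h1, ← Matrix.mul_assoc,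
    trace_mul_comm _ M, ← Matrix.mul_assoc, sub_self]

theorem trace_adjugate_mul_re_im {D B : Matrix n n ℝ} {z₀ : ℂ} (hz₀ : z₀.im ≠ 0)
    {K : Matrix n n ℂ}
    (hK : (complexify D * K - K * complexify D) +
      z₀ • (complexify B * K - K * complexify B) = 0) (x y z : ℝ) :
    trace (adjugate (scalar n x - (y • D + z • B)) *
      (z • (complexify B * K - K * complexify B).map Complex.re)) = 0 ∧
    trace (adjugate (scalar n x - (y • D + z • B)) *
      (z • (complexify B * K - K * complexify B).map Complex.im)) = 0 := by
  set δ := complexify B * K - K * complexify B with hδ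
  set N := adjugate (scalar n x - (y • D + z • B)) with hN
  have h1 : complexify N = adjugate (scalar n (x : ℂ) -
      ((y : ℂ) • complexify D + (z : ℂ) • complexify B)) := by
    rw [← complexify_smul_add_smul, hN]
    have := RingHom.map_adjugate (algebraMap ℝ ℂ) (scalar n x - (y • D + z • B))
    simp only [RingHom.mapMatrix_apply] at this
    rw [complexify, this]
    congr 1
    ext i j
    by_cases h : i = j <;> simp [complexify, h]
  have h2 := trace_adjugate_mul_commutator (x : ℂ)
    ((y : ℂ) • complexify D + (z : ℂ) • complexify B) K
  have h3 : ((y : ℂ) • complexify D + (z : ℂ) • complexify B) * K -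
      K * ((y : ℂ) • complexify D + (z : ℂ) • complexify B) = ((z : ℂ) - y * z₀) • δ := by
    have h4 := eq_neg_of_add_eq_zero_left hK
    rw [Matrix.add_mul, Matrix.mul_add, Matrix.smul_mul, Matrix.smul_mul, Matrix.mul_smul,
      Matrix.mul_smul, add_sub_add_comm, ← smul_sub, ← smul_sub, h4, ← hδ]
    module
  rw [h3, ← h1, Matrix.mul_smul, trace_smul, smul_eq_mul, mul_eq_zero] at h2
  have h5 : (z : ℂ) * trace (complexify N * δ) = 0 := by
    rcases h2 with h2 | h2
    · have him := congrArg Complex.im h2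
      have hre := congrArg Complex.re h2
      simp at him hre
      have hy : y = 0 := him.resolve_right hz₀
      rw [hy] at hre
      simp at hre
      rw [hre]; simp
    · rw [h2, mul_zero]
  rw [Matrix.mul_smul, Matrix.mul_smul, trace_smul, trace_smul]
  constructor
  · have := congrArg Complex.re h5
    rw [Complex.re_ofReal_mul] at this
    simpa [trace, Matrix.mul_apply, complexify] using this
  · have := congrArg Complex.im h5
    rw [Complex.im_ofReal_mul] at this
    simpa [trace, Matrix.mul_apply, complexify] using this

theorem complexify_commutator_conj {n : Type*} [Fintype n] (M : Matrix n n ℝ) (K : Matrix n n ℂ) :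
    complexify M * K.map (starRingEnd ℂ) - K.map (starRingEnd ℂ) * complexify M =
      (complexify M * K - K * complexify M).map (starRingEnd ℂ) := by
  ext i j
  simp [Matrix.mul_apply, complexify]

theorem eq_zero_of_re_im_dependent {D B : Matrix n n ℝ} (hB : B.IsSymm)
    (hBs : B.charpoly.Separable) {z₀ : ℂ} (hz₀ : z₀.im ≠ 0) {K : Matrix n n ℂ} (hKs : Kᵀ = -K)
    (hK0 : K ≠ 0)
    (hK : (complexify D * K - K * complexify D) +
      z₀ • (complexify B * K - K * complexify B) = 0) {s t : ℝ}
    (hst : s • (complexify B * K - K * complexify B).map Complex.re +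
      t • (complexify B * K - K * complexify B).map Complex.im = 0) : s = 0 ∧ t = 0 := by
  set c : ℂ := ⟨t, s⟩ with hc
  set L := c • K with hL
  have hLs : Lᵀ = -L := by rw [hL, transpose_smul, hKs, smul_neg]
  have hcomm : ∀ M : Matrix n n ℂ, M * L - L * M = c • (M * K - K * M) := by
    intro M
    rw [hL, Matrix.mul_smul, Matrix.smul_mul, smul_sub]
  have hreal : (complexify B * L - L * complexify B).map (starRingEnd ℂ) =
      complexify B * L - L * complexify B := by
    rw [hcomm]
    ext i j
    rw [Matrix.map_apply, Complex.conj_eq_iff_im]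
    have := congrFun (congrFun hst i) j
    simp only [Matrix.add_apply, Matrix.smul_apply, Matrix.map_apply, Matrix.zero_apply,
      smul_eq_mul] at this
    rw [Matrix.smul_apply, smul_eq_mul, Complex.mul_im]
    simp only [hc]
    linarith
  have hLD : (complexify D * L - L * complexify D) =
      -(z₀ • (complexify B * L - L * complexify B)) := by
    rw [hcomm, hcomm, eq_neg_of_add_eq_zero_left hK, smul_neg, smul_comm]
  have hLc : L.map (starRingEnd ℂ) = L := by
    rw [← sub_eq_zero]
    apply eq_zero_of_skew_of_commute hB hBs
    · rw [transpose_sub, hLs, ← transpose_map, hLs]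
      ext i j; simp; ring
    · rw [Matrix.mul_sub, Matrix.sub_mul, sub_sub_sub_comm, complexify_commutator_conj, hreal,
        sub_self]
  have hz : (z₀ - (starRingEnd ℂ) z₀) • (complexify B * L - L * complexify B) = 0 := by
    have h1 := complexify_commutator_conj D L
    rw [hLc, hLD] at h1
    have h2 : (-(z₀ • (complexify B * L - L * complexify B))).map (starRingEnd ℂ) =
        -((starRingEnd ℂ) z₀ • (complexify B * L - L * complexify B).map (starRingEnd ℂ)) := by
      ext i j
      simp only [Matrix.map_apply, Matrix.neg_apply, Matrix.smul_apply, smul_eq_mul, map_neg,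
        map_mul]
    rw [h2, hreal] at h1
    rw [sub_smul, neg_injective h1, sub_self]
  have hne : z₀ - (starRingEnd ℂ) z₀ ≠ 0 := by
    rw [sub_ne_zero]
    intro h
    exact hz₀ (Complex.conj_eq_iff_im.1 h.symm)
  have hL0 : L = 0 := eq_zero_of_skew_of_commute hB hBs hLs ((smul_eq_zero.1 hz).resolve_left hne)
  have hc0 : c = 0 := (smul_eq_zero.1 hL0).resolve_right hK0
  exact ⟨congrArg Complex.im hc0, congrArg Complex.re hc0⟩

variable {m : ℕ} {F : DiagSym m → TernaryCoeff m}

theorem fderiv_apply_eq_zero_iff (hF : Differentiable ℝ F)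
    (hch : ∀ v y z, ternary (F v) y z = (y • diagonal v.1 + z • symMatrix v.2).charpoly)
    (v δ : DiagSym m) :
    fderiv ℝ F v δ = 0 ↔ ∀ x y z : ℝ,
      trace (adjugate (scalar (Fin m) x - (y • diagonal v.1 + z • symMatrix v.2)) *
        (y • diagonal δ.1 + z • symMatrix δ.2)) = 0 := by
  have h := eval_ternaryTail_fderiv hF hch v δ
  constructor
  · intro h0 x y z
    have := h x y z
    rw [h0, ← zero_smul ℝ (0 : TernaryCoeff m), ternaryTail_smul] at this
    simpa using this.symm
  · intro h0
    refine eq_zero_of_ternaryTail_eq_zero fun z => Polynomial.funext fun x => ?_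
    rw [h, h0]; simp

theorem isSymm_pencil (v : DiagSym m) (y z : ℝ) :
    (y • diagonal v.1 + z • symMatrix v.2).IsSymm :=
  ((isSymm_diagonal v.1).smul y).add ((isSymm_symMatrix v.2).smul z)

theorem symMatrix_injective : Function.Injective (symMatrix (m := m)) := by
  intro b b' h
  funext p
  induction p with
  | _ i j => exact congrFun (congrFun h i) j

theorem ker_fderiv_eq_bot (hF : Differentiable ℝ F)
    (hch : ∀ v y z, ternary (F v) y z = (y • diagonal v.1 + z • symMatrix v.2).charpoly)
    {v : DiagSym m} (hs : ∀ y z : ℝ, y ≠ 0 ∨ z ≠ 0 →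
      (y • diagonal v.1 + z • symMatrix v.2).charpoly.Separable)
    (hno : NoCommutingSkew (diagonal v.1) (symMatrix v.2)) : (fderiv ℝ F v).ker = ⊥ := by
  rw [LinearMap.ker_eq_bot']
  intro δ hδ
  have h := (fderiv_apply_eq_zero_iff hF hch v δ).1 hδ
  have hK : ∀ z : ℝ, ∃ K : Matrix (Fin m) (Fin m) ℝ, Kᵀ = -K ∧
      (diagonal v.1 + z • symMatrix v.2) * K - K * (diagonal v.1 + z • symMatrix v.2) =
        diagonal δ.1 + z • symMatrix δ.2 := by
    intro z
    have h1 := isSymm_pencil v 1 z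
    have h2 := hs 1 z (Or.inl one_ne_zero)
    have h3 := isSymm_pencil δ 1 z
    have h4 := fun x => h x 1 z
    simp only [one_smul] at h1 h2 h3 h4
    exact exists_skew_of_trace_adjugate_eq_zero h1 h2 h3 h4
  have hδ1 : δ.1 = 0 := by
    obtain ⟨K, -, hK0⟩ := hK 0
    funext i
    have := congrFun (congrFun hK0 i) i
    simp only [zero_smul, add_zero, Matrix.sub_apply, diagonal_mul, mul_diagonal,
      diagonal_apply_eq] at this
    rw [← this]; simp [mul_comm]
  have hB := hs 0 1 (Or.inr one_ne_zero)
  simp only [zero_smul, one_smul, zero_add] at hB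
  have hδ2 : symMatrix δ.2 = 0 := by
    refine eq_zero_of_forall_exists_skew (isSymm_symMatrix v.2) hB hno fun z hz => ?_
    obtain ⟨K, hKs, hKz⟩ := hK z
    refine ⟨z⁻¹ • K, by rw [transpose_smul, hKs, smul_neg], ?_⟩
    rw [Matrix.mul_smul, Matrix.smul_mul, ← smul_sub, hKz, hδ1]
    simp [smul_smul, inv_mul_cancel₀ hz]
  refine Prod.ext hδ1 (symMatrix_injective ?_)
  rw [hδ2]; rfl

theorem two_le_finrank_ker_fderiv (hF : Differentiable ℝ F)
    (hch : ∀ v y z, ternary (F v) y z = (y • diagonal v.1 + z • symMatrix v.2).charpoly)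
    {v : DiagSym m} (hs : ∀ y z : ℝ, y ≠ 0 ∨ z ≠ 0 →
      (y • diagonal v.1 + z • symMatrix v.2).charpoly.Separable)
    (hno : ¬ NoCommutingSkew (diagonal v.1) (symMatrix v.2)) :
    2 ≤ Module.finrank ℝ (fderiv ℝ F v).ker := by
  simp only [NoCommutingSkew, not_forall] at hno
  obtain ⟨z₀, K, hKs, hK, hK0⟩ := hno
  have hz₀ : z₀.im ≠ 0 := by
    intro him
    apply hK0
    refine eq_zero_of_skew_of_commute (isSymm_pencil v 1 z₀.re) (hs _ _ (Or.inl one_ne_zero)) hKs ?_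
    rw [complexify_smul_add_smul, ← hK, show (z₀.re : ℂ) = z₀ from Complex.ext rfl (by simp [him])]
    simp only [Complex.ofReal_one, one_smul, Matrix.add_mul, Matrix.mul_add, Matrix.smul_mul,
      Matrix.mul_smul, smul_sub]
    abel
  have hB := hs 0 1 (Or.inr one_ne_zero)
  simp only [zero_smul, one_smul, zero_add] at hB
  have hδs : (complexify (symMatrix v.2) * K - K * complexify (symMatrix v.2)).IsSymm := by
    have : (complexify (symMatrix v.2))ᵀ = complexify (symMatrix v.2) := by
      rw [complexify, ← transpose_map, (isSymm_symMatrix v.2).eq]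
    rw [Matrix.IsSymm, transpose_sub, transpose_mul, transpose_mul, hKs, this]
    simp; abel
  obtain ⟨b₁, hb₁⟩ := exists_eq_symMatrix (hδs.map Complex.re)
  obtain ⟨b₂, hb₂⟩ := exists_eq_symMatrix (hδs.map Complex.im)
  have hmem := trace_adjugate_mul_re_im hz₀ hK
  have h1 : fderiv ℝ F v (0, b₁) = 0 := by
    rw [fderiv_apply_eq_zero_iff hF hch]
    intro x y z
    have := (hmem x y z).1
    rw [← hb₁] at this
    simpa using this
  have h2 : fderiv ℝ F v (0, b₂) = 0 := by
    rw [fderiv_apply_eq_zero_iff hF hch]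
    intro x y z
    have := (hmem x y z).2
    rw [← hb₂] at this
    simpa using this
  let κ₁ : (fderiv ℝ F v).ker := ⟨(0, b₁), h1⟩
  let κ₂ : (fderiv ℝ F v).ker := ⟨(0, b₂), h2⟩
  have hli : LinearIndependent ℝ ![κ₁, κ₂] := by
    rw [LinearIndependent.pair_iff]
    intro s t hst
    refine eq_zero_of_re_im_dependent (isSymm_symMatrix v.2) hB hz₀ hKs hK0 hK ?_
    rw [← hb₁, ← hb₂]
    have h3 : s • b₁ + t • b₂ = 0 := congrArg (fun κ : (fderiv ℝ F v).ker => (κ : DiagSym m).2) hst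
    ext i j
    exact congrFun h3 s(i, j)
  simpa using hli.fintype_card_le_finrank

end Kernel

section RegularPoint

theorem Matrix.IsSymm.aeval {n : Type*} [Fintype n] [DecidableEq n] {M : Matrix n n ℂ}
    (hM : M.IsSymm) (q : ℂ[X]) : (Polynomial.aeval M q).IsSymm := by
  induction q using Polynomial.induction_on' with
  | add p q hp hq => rw [map_add]; exact hp.add hq
  | monomial k c =>
    rw [aeval_monomial, Algebra.algebraMap_eq_smul_one, smul_mul_assoc, one_mul]
    exact (hM.pow k).smul c

/-- A symmetric matrix commuting with no nonzero skew-symmetric matrix: the tridiagonal case. -/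
theorem eq_zero_of_skew_of_commute_hessenberg {m : ℕ} {M K : Matrix (Fin m) (Fin m) ℂ}
    (hM : M.IsSymm) (hsub : ∀ i j : Fin m, (i : ℕ) = j + 1 → M i j ≠ 0)
    (hlow : ∀ i j : Fin m, (j : ℕ) + 1 < i → M i j = 0)
    (hK : Kᵀ = -K) (hc : M * K = K * M) : K = 0 := by
  rcases Nat.eq_zero_or_pos m with rfl | hm
  · ext i; exact i.elim0
  let o : Fin m := ⟨0, hm⟩
  let S : Submodule ℂ (Fin m → ℂ) :=
    { carrier := {w | ∃ q : ℂ[X], (aeval M q) *ᵥ Pi.single o 1 = w}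
      add_mem' := by
        rintro _ _ ⟨q, rfl⟩ ⟨r, rfl⟩
        exact ⟨q + r, by rw [map_add, add_mulVec]⟩
      zero_mem' := ⟨0, by rw [map_zero, zero_mulVec]⟩
      smul_mem' := by
        rintro c _ ⟨q, rfl⟩
        exact ⟨c • q, by rw [map_smul, smul_mulVec]⟩ }
  have hSM : ∀ w ∈ S, M *ᵥ w ∈ S := by
    rintro _ ⟨q, rfl⟩
    exact ⟨X * q, by rw [map_mul, aeval_X, mulVec_mulVec]⟩
  have hS : ∀ (k : ℕ) (hk : k < m), Pi.single (⟨k, hk⟩ : Fin m) (1 : ℂ) ∈ S := by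
    intro k
    induction k using Nat.strong_induction_on with
    | _ k ih =>
      intro hk
      rcases Nat.eq_zero_or_pos k with rfl | hk0
      · exact ⟨1, by rw [map_one, one_mulVec]⟩
      · obtain ⟨l, rfl⟩ : ∃ l, k = l + 1 := ⟨k - 1, by omega⟩
        have hl : l < m := by omega
        have h1 := hSM _ (ih l (by omega) hl)
        have h2 : M *ᵥ Pi.single (⟨l, hl⟩ : Fin m) (1 : ℂ) =
            ∑ i, M i ⟨l, hl⟩ • Pi.single i (1 : ℂ) := by
          rw [mulVec_single_one]
          exact (pi_eq_sum_univ' _).trans (Finset.sum_congr rfl fun i _ => by congr 1)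
        rw [h2, ← Finset.add_sum_erase _ _ (Finset.mem_univ ⟨l + 1, hk⟩)] at h1
        have h3 : ∑ i ∈ Finset.univ.erase ⟨l + 1, hk⟩, M i ⟨l, hl⟩ • Pi.single i (1 : ℂ) ∈ S := by
          refine S.sum_mem fun i hi => ?_
          have hne : (i : ℕ) ≠ l + 1 := fun h => Finset.ne_of_mem_erase hi (Fin.ext h)
          rcases lt_or_gt_of_ne hne with h | h
          · exact S.smul_mem _ (ih i h i.2)
          · rw [hlow i ⟨l, hl⟩ h, zero_smul]; exact S.zero_mem
        have h4 := (S.add_mem_iff_left h3).1 h1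
        exact (S.smul_mem_iff (hsub ⟨l + 1, hk⟩ ⟨l, hl⟩ rfl)).1 h4
  ext j k
  obtain ⟨p, hp⟩ := hS j j.2
  obtain ⟨q, hq⟩ := hS k k.2
  have hcomm : ∀ r : ℂ[X], Commute K (aeval M r) := by
    intro r
    induction r using Polynomial.induction_on' with
    | add p q hp hq => rw [map_add]; exact hp.add_right hq
    | monomial i c =>
      rw [aeval_monomial]
      exact (Algebra.commute_algebraMap_right c K).mul_right
        (Commute.pow_right (show Commute K M from hc.symm) i)
  have hpq : Commute (aeval M p) (aeval M q) := by
    rw [Commute, SemiconjBy, ← map_mul, ← map_mul, mul_comm]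
  set Z := aeval M p * K * aeval M q with hZ
  have hZs : Zᵀ = -Z := by
    rw [hZ, transpose_mul, transpose_mul, (hM.aeval p).eq, (hM.aeval q).eq, hK, Matrix.neg_mul,
      Matrix.mul_neg, (hcomm p).eq, ← Matrix.mul_assoc, hpq.symm.eq, Matrix.mul_assoc,
      (hcomm q).symm.eq, Matrix.mul_assoc]
  have hZ0 : Z o o = 0 := by
    have := congrFun (congrFun hZs o) o
    rw [transpose_apply, Matrix.neg_apply] at this
    exact self_eq_neg.1 this
  have h1 : Z o o = Pi.single o 1 ⬝ᵥ Z *ᵥ Pi.single o 1 := by simp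
  have h2 : K j k = Pi.single j 1 ⬝ᵥ K *ᵥ Pi.single k 1 := by simp
  rw [Matrix.zero_apply, h2, ← hZ0, h1, hZ]
  rw [← mulVec_mulVec, ← mulVec_mulVec, hq, dotProduct_mulVec _ (aeval M p), ← mulVec_transpose,
    (hM.aeval p).eq, hp]

theorem Matrix.IsSymm.separable_charpoly_of_commute {n : Type*} [Fintype n] [DecidableEq n]
    {M : Matrix n n ℝ} (hM : M.IsSymm)
    (h : ∀ K : Matrix n n ℂ, Kᵀ = -K → complexify M * K = K * complexify M → K = 0) :
    M.charpoly.Separable := by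
  obtain ⟨O, r, hO, hO', hMO, hch⟩ := hM.exists_spectral
  rw [hch, separable_prod_X_sub_C_iff]
  intro i j hij
  by_contra hne
  set E : Matrix n n ℝ := single i j 1 - single j i 1 with hE
  have hEs : Eᵀ = -E := by rw [hE]; simp
  have hEc : diagonal r * E = E * diagonal r := by
    ext a b
    rw [diagonal_mul, mul_diagonal, hE]
    simp only [Matrix.sub_apply, single_apply]
    by_cases h1 : i = a ∧ j = b
    · obtain ⟨rfl, rfl⟩ := h1; rw [hij]; ring
    · by_cases h2 : j = a ∧ i = b
      · obtain ⟨rfl, rfl⟩ := h2; rw [hij]; ring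
      · simp [h1, h2]
  have h1 := h (complexify (O * E * Oᵀ)) (by
    rw [complexify, ← transpose_map, transpose_mul, transpose_mul, transpose_transpose, hEs]
    ext a b; simp [Matrix.mul_assoc]) (by
    rw [← sub_eq_zero, complexify_commutator]
    have : M * (O * E * Oᵀ) - O * E * Oᵀ * M = 0 := by
      rw [sub_eq_zero, hMO]
      rw [show O * diagonal r * Oᵀ * (O * E * Oᵀ) = O * diagonal r * (Oᵀ * O) * E * Oᵀ by
          simp only [Matrix.mul_assoc],
        show O * E * Oᵀ * (O * diagonal r * Oᵀ) = O * E * (Oᵀ * O) * diagonal r * Oᵀ by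
          simp only [Matrix.mul_assoc], hO', Matrix.mul_one, Matrix.mul_one,
        Matrix.mul_assoc O, hEc, ← Matrix.mul_assoc]
    rw [this]; ext a b; simp [complexify])
  have h2 : O * E * Oᵀ = 0 := by
    apply complexify_injective
    rw [h1]; ext a b; simp [complexify]
  have h3 : E = 0 := by
    rw [show E = (Oᵀ * O) * E * (Oᵀ * O) by rw [hO', Matrix.one_mul, Matrix.mul_one],
      show (Oᵀ * O) * E * (Oᵀ * O) = Oᵀ * (O * E * Oᵀ) * O by simp only [Matrix.mul_assoc], h2]
    simp
  have h4 := congrFun (congrFun h3 i) j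
  rw [hE] at h4
  simp [Ne.symm hne] at h4

theorem exists_noCommutingSkew (m : ℕ) : ∃ v : DiagSym m,
    NoCommutingSkew (diagonal v.1) (symMatrix v.2) ∧ ∀ y z : ℝ, y ≠ 0 ∨ z ≠ 0 →
      (y • diagonal v.1 + z • symMatrix v.2).charpoly.Separable := by
  let B : Matrix (Fin m) (Fin m) ℝ := Matrix.of fun i j =>
    if (i : ℕ) = j + 1 ∨ (j : ℕ) = i + 1 then 1 else 0
  have hB : B.IsSymm := by
    ext i j
    simp only [B, transpose_apply, of_apply, or_comm]
  obtain ⟨b, hb⟩ := exists_eq_symMatrix hB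
  have key : ∀ (y z : ℂ), y ≠ 0 ∨ z ≠ 0 → ∀ K : Matrix (Fin m) (Fin m) ℂ, Kᵀ = -K →
      (y • complexify (diagonal fun i : Fin m => (i : ℝ)) + z • complexify B) * K =
        K * (y • complexify (diagonal fun i : Fin m => (i : ℝ)) + z • complexify B) → K = 0 := by
    intro y z hyz K hK hc
    by_cases hz : z = 0
    · have hy : y ≠ 0 := hyz.resolve_right (not_not.2 hz)
      rw [hz, zero_smul, add_zero, Matrix.smul_mul, Matrix.mul_smul] at hc
      have hc := smul_right_injective _ hy hc
      have hd : complexify (diagonal fun i : Fin m => (i : ℝ)) =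
          diagonal fun i : Fin m => (i : ℂ) := by
        rw [complexify, diagonal_map (by simp)]; simp
      ext i j
      by_cases hij : i = j
      · subst hij
        have := congrFun (congrFun hK i) i
        rw [transpose_apply, Matrix.neg_apply] at this
        exact self_eq_neg.1 this
      · have := congrFun (congrFun hc i) j
        rw [hd, diagonal_mul, mul_diagonal, mul_comm (K i j), ← sub_eq_zero, ← sub_mul] at this
        refine (mul_eq_zero.1 this).resolve_left (sub_ne_zero.2 fun h => hij (Fin.ext ?_))
        exact_mod_cast h
    · refine eq_zero_of_skew_of_commute_hessenberg (M := _) ?_ ?_ ?_ hK hc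
      · refine (Matrix.IsSymm.smul ?_ y).add (Matrix.IsSymm.smul ?_ z)
        · exact (isSymm_diagonal _).map _
        · exact hB.map _
      · intro i j hij
        have hne : i ≠ j := by rintro rfl; omega
        simp [complexify, diagonal_apply_ne _ hne, B, hij, hz]
      · intro i j hij
        have hne : i ≠ j := by rintro rfl; omega
        have : ¬ ((i : ℕ) = j + 1 ∨ (j : ℕ) = i + 1) := by omega
        simp [complexify, diagonal_apply_ne _ hne, B, this]
  refine ⟨(fun i => (i : ℝ), b), ?_, ?_⟩
  · intro z K hK hc
    rw [hb] at hc
    refine key 1 z (Or.inl one_ne_zero) K hK ?_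
    rw [← sub_eq_zero, ← hc]
    simp only [one_smul, Matrix.add_mul, Matrix.mul_add, Matrix.smul_mul,
      Matrix.mul_smul, smul_sub]
    abel
  · intro y z hyz
    refine (isSymm_pencil _ y z).separable_charpoly_of_commute fun K hK hc => ?_
    rw [complexify_smul_add_smul, hb] at hc
    exact key y z (by simpa using hyz) K hK hc

end RegularPoint

section RealRooted

/-- The operator `1 + c d/dx` on real polynomials. -/
noncomputable def addDeriv (c : ℝ) (p : ℝ[X]) : ℝ[X] := p + C c * derivative p

theorem degree_C_mul_derivative_lt {p : ℝ[X]} (hp : p ≠ 0) (c : ℝ) :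
    (C c * derivative p).degree < p.degree := by
  rw [← smul_eq_C_mul]
  exact (degree_smul_le _ _).trans_lt (degree_derivative_lt hp)

theorem monic_addDeriv {p : ℝ[X]} (hp : p.Monic) (c : ℝ) : (addDeriv c p).Monic :=
  hp.add_of_left (degree_C_mul_derivative_lt hp.ne_zero c)

theorem natDegree_addDeriv {p : ℝ[X]} (hp : p.Monic) (c : ℝ) :
    (addDeriv c p).natDegree = p.natDegree :=
  natDegree_eq_of_degree_eq (degree_add_eq_left_of_degree_lt
    (degree_C_mul_derivative_lt hp.ne_zero c))

theorem addDeriv_zero (p : ℝ[X]) : addDeriv 0 p = p := by simp [addDeriv]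

theorem monic_addDeriv_iterate {p : ℝ[X]} (hp : p.Monic) (c : ℝ) (n : ℕ) :
    ((addDeriv c)^[n] p).Monic := by
  induction n with
  | zero => exact hp
  | succ n ih => rw [Function.iterate_succ_apply']; exact monic_addDeriv ih c

theorem natDegree_addDeriv_iterate {p : ℝ[X]} (hp : p.Monic) (c : ℝ) (n : ℕ) :
    ((addDeriv c)^[n] p).natDegree = p.natDegree := by
  induction n with
  | zero => rfl
  | succ n ih =>
    rw [Function.iterate_succ_apply', natDegree_addDeriv (monic_addDeriv_iterate hp c n), ih]

/-- A real polynomial without non-real complex roots splits. -/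
theorem splits_of_forall_im_pos {p : ℝ[X]} (hp : p ≠ 0)
    (h : ∀ w : ℂ, 0 < w.im → aeval w p ≠ 0) : p.Splits := by
  refine Splits.of_splits_map (algebraMap ℝ ℂ) (IsAlgClosed.splits _) fun w hw => ?_
  have hw : aeval w p = 0 := by
    rw [mem_roots (by simpa using hp), IsRoot.def, eval_map_algebraMap] at hw
    exact hw
  have him : w.im = 0 := by
    rcases lt_trichotomy w.im 0 with h1 | h1 | h1
    · refine absurd ?_ (h (starRingEnd ℂ w) (by simpa using h1))
      rw [aeval_conj, hw, map_zero]
    · exact h1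
    · exact absurd hw (h w h1)
  exact ⟨w.re, Complex.ext (by simp) (by simp [him])⟩

theorem im_sum_inv_sub_neg {s : Multiset ℝ} (hs : s ≠ 0) {w : ℂ} (hw : 0 < w.im) :
    ((s.map fun a : ℝ => 1 / (w - (a : ℂ))).sum).im < 0 := by
  have hone : ∀ a : ℝ, (1 / (w - (a : ℂ))).im < 0 := by
    intro a
    have hne : w - (a : ℂ) ≠ 0 := fun h => by
      have := congrArg Complex.im h
      simp at this
      linarith
    rw [one_div, Complex.inv_im]
    refine div_neg_of_neg_of_pos ?_ (Complex.normSq_pos.2 hne)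
    simpa using hw
  have hle : ∀ t : Multiset ℝ, ((t.map fun a : ℝ => 1 / (w - (a : ℂ))).sum).im ≤ 0 := by
    intro t
    induction t using Multiset.induction with
    | empty => simp
    | cons a t ih =>
      rw [Multiset.map_cons, Multiset.sum_cons, Complex.add_im]
      linarith [hone a]
  obtain ⟨a, ha⟩ := Multiset.exists_mem_of_ne_zero hs
  obtain ⟨t, rfl⟩ := Multiset.exists_cons_of_mem ha
  rw [Multiset.map_cons, Multiset.sum_cons, Complex.add_im]
  linarith [hone a, hle t]

theorem aeval_ne_zero_of_splits {p : ℝ[X]} (hp : p ≠ 0) (hs : p.Splits) {w : ℂ}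
    (hw : 0 < w.im) : aeval w p ≠ 0 := by
  intro h
  obtain ⟨r, hr⟩ := hs.mem_range_of_isRoot (i := algebraMap ℝ ℂ) hp
    (by rw [IsRoot.def, eval_map_algebraMap]; exact h)
  rw [← hr] at hw
  simp at hw

theorem splits_addDeriv {p : ℝ[X]} (hp : p.Monic) (hs : p.Splits) (c : ℝ) :
    (addDeriv c p).Splits := by
  by_cases h0 : p.natDegree = 0
  · exact Splits.of_natDegree_eq_zero (by rw [natDegree_addDeriv hp, h0])
  refine splits_of_forall_im_pos (monic_addDeriv hp c).ne_zero fun w hw h => ?_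
  have hpw := aeval_ne_zero_of_splits hp.ne_zero hs hw
  have hpw2 : (p.map (algebraMap ℝ ℂ)).eval w ≠ 0 := by rwa [eval_map_algebraMap]
  have hd := (hs.map (algebraMap ℝ ℂ)).eval_derivative_div_eval_of_ne_zero hpw2
  rw [hs.roots_map, Multiset.map_map, derivative_map, eval_map_algebraMap,
    eval_map_algebraMap] at hd
  have him := im_sum_inv_sub_neg (hs.roots_ne_zero h0) hw
  have hd2 : aeval w (derivative p) / aeval w p =
      (p.roots.map fun a : ℝ => 1 / (w - (a : ℂ))).sum := hd
  rw [← hd2] at him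
  have h2 : aeval w p + (c : ℂ) * aeval w (derivative p) = 0 := by
    simpa [addDeriv] using h
  have h3 : (c : ℂ) * (aeval w (derivative p) / aeval w p) = -1 := by
    field_simp
    linear_combination h2
  have h4 := congrArg Complex.im h3
  have h5 := congrArg Complex.re h3
  simp only [Complex.re_ofReal_mul, Complex.im_ofReal_mul] at h4 h5
  rcases mul_eq_zero.1 (h4.trans (by simp)) with h6 | h6
  · rw [h6] at h5
    simp at h5
  · linarith

theorem eval_mul_derivative_derivative_le_sq (s : Multiset ℝ) (x : ℝ) :
    0 ≤ (derivative (s.map fun a => X - C a).prod).eval x ^ 2 -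
      (s.map fun a => X - C a).prod.eval x *
        (derivative (derivative (s.map fun a => X - C a).prod)).eval x := by
  induction s using Multiset.induction with
  | empty => simp
  | cons a s ih =>
    set q := (s.map fun a => X - C a).prod
    simp only [Multiset.map_cons, Multiset.prod_cons, derivative_mul, derivative_sub,
      derivative_X, derivative_C, sub_zero, one_mul, derivative_add, eval_add, eval_mul,
      eval_sub, eval_X, eval_C]
    have := mul_nonneg (sq_nonneg (x - a)) ih
    nlinarith [sq_nonneg (q.eval x)]

theorem eval_mul_derivative_derivative_lt_sq {s : Multiset ℝ} (hs : s ≠ 0) {x : ℝ}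
    (hx : (s.map fun a => X - C a).prod.eval x ≠ 0) :
    0 < (derivative (s.map fun a => X - C a).prod).eval x ^ 2 -
      (s.map fun a => X - C a).prod.eval x *
        (derivative (derivative (s.map fun a => X - C a).prod)).eval x := by
  obtain ⟨a, ha⟩ := Multiset.exists_mem_of_ne_zero hs
  obtain ⟨t, rfl⟩ := Multiset.exists_cons_of_mem ha
  have ih := eval_mul_derivative_derivative_le_sq t x
  set q := (t.map fun a => X - C a).prod
  have hq : q.eval x ≠ 0 := fun h => hx (by simp [q, h])
  simp only [Multiset.map_cons, Multiset.prod_cons, derivative_mul, derivative_sub,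
    derivative_X, derivative_C, sub_zero, one_mul, derivative_add, eval_add, eval_mul,
    eval_sub, eval_X, eval_C]
  have := mul_nonneg (sq_nonneg (x - a)) ih
  have := pow_pos (abs_pos.2 hq) 2
  rw [sq_abs] at this
  nlinarith

theorem rootMultiplicity_addDeriv_le {p : ℝ[X]} (hp : p.Monic) (hs : p.Splits) {c : ℝ}
    (hc : c ≠ 0) (r : ℝ) :
    rootMultiplicity r (addDeriv c p) ≤ max 1 (rootMultiplicity r p - 1) := by
  have hq0 := (monic_addDeriv hp c).ne_zero
  by_cases hr : p.IsRoot r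
  · refine le_max_of_le_right ?_
    by_contra! hlt
    have hd := derivative_rootMultiplicity_of_root hr
    have hpos : 0 < rootMultiplicity r p := (rootMultiplicity_pos hp.ne_zero).2 hr
    have hd0 : derivative p ≠ 0 := by
      intro h
      have := derivative_eq_zero.1 h
      have h1 := hp.natDegree_eq_zero.1 this
      rw [h1] at hr
      simp at hr
    have h1 : (X - C r) ^ (rootMultiplicity r p) ∣ addDeriv c p :=
      (pow_dvd_pow _ (by omega)).trans (pow_rootMultiplicity_dvd _ r)
    have h2 : (X - C r) ^ (rootMultiplicity r p) ∣ C c * derivative p :=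
      (dvd_add_right (pow_rootMultiplicity_dvd p r)).1 h1
    have h3 : (X - C r) ^ (rootMultiplicity r p) ∣ derivative p := by
      have := h2.mul_left (C c⁻¹)
      rwa [← mul_assoc, ← C_mul, inv_mul_cancel₀ hc, C_1, one_mul] at this
    have := (le_rootMultiplicity_iff hd0).2 h3
    omega
  · refine le_max_of_le_left ?_
    by_contra! hlt
    obtain ⟨h1, h2⟩ := (one_lt_rootMultiplicity_iff_isRoot hq0).1 hlt
    by_cases h0 : p.roots = 0
    · have hp1 : p = 1 := by
        have := hs.eq_prod_roots_of_monic hp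
        simpa [h0] using this
      rw [hp1] at h1
      simp [addDeriv] at h1
    have heq := hs.eq_prod_roots_of_monic hp
    have hlt := eval_mul_derivative_derivative_lt_sq h0 (x := r) (by rwa [← heq])
    rw [← heq] at hlt
    simp only [addDeriv, IsRoot.def, eval_add, eval_mul, eval_C, derivative_add,
      derivative_mul, derivative_C, zero_mul, zero_add] at h1 h2
    have h3 : c * (eval r (derivative p) ^ 2 - eval r p * eval r (derivative (derivative p)))
        = 0 := by
      linear_combination eval r (derivative p) * h1 - eval r p * h2
    rcases mul_eq_zero.1 h3 with h | h
    · exact hc h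
    · linarith

theorem splits_addDeriv_iterate {p : ℝ[X]} (hp : p.Monic) (hs : p.Splits) (c : ℝ) (n : ℕ) :
    ((addDeriv c)^[n] p).Splits := by
  induction n with
  | zero => exact hs
  | succ n ih =>
    rw [Function.iterate_succ_apply']
    exact splits_addDeriv (monic_addDeriv_iterate hp c n) ih c

theorem rootMultiplicity_addDeriv_iterate_le {p : ℝ[X]} (hp : p.Monic) (hs : p.Splits) {c : ℝ}
    (hc : c ≠ 0) (r : ℝ) (n : ℕ) :
    rootMultiplicity r ((addDeriv c)^[n] p) ≤ max 1 (rootMultiplicity r p - n) := by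
  induction n with
  | zero => exact le_max_right _ _
  | succ n ih =>
    rw [Function.iterate_succ_apply']
    have := rootMultiplicity_addDeriv_le (monic_addDeriv_iterate hp c n)
      (splits_addDeriv_iterate hp hs c n) hc r
    omega

theorem separable_of_rootMultiplicity_le_one {p : ℝ[X]} (hp : p ≠ 0) (hs : p.Splits)
    (h : ∀ r, rootMultiplicity r p ≤ 1) : p.Separable := by
  classical
  rw [← nodup_roots_iff_of_splits hp hs, Multiset.nodup_iff_count_le_one]
  intro r
  rw [count_roots]
  exact h r

theorem separable_addDeriv_iterate {p : ℝ[X]} (hp : p.Monic) (hs : p.Splits) {c : ℝ}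
    (hc : c ≠ 0) {n : ℕ} (hn : p.natDegree ≤ n) : ((addDeriv c)^[n] p).Separable := by
  refine separable_of_rootMultiplicity_le_one (monic_addDeriv_iterate hp c n).ne_zero
    (splits_addDeriv_iterate hp hs c n) fun r => ?_
  have h1 := rootMultiplicity_addDeriv_iterate_le hp hs hc r n
  have h2 : rootMultiplicity r p ≤ p.natDegree := by
    classical
    rw [← count_roots]
    exact (Multiset.count_le_card _ _).trans (card_roots' p)
  omega

theorem separable_addDeriv_iterate_of_separable {p : ℝ[X]} (hp : p.Monic) (hs : p.Splits)
    (hsep : p.Separable) (c : ℝ) (n : ℕ) : ((addDeriv c)^[n] p).Separable := by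
  by_cases hc : c = 0
  · subst hc
    rwa [Function.iterate_fixed (addDeriv_zero p)]
  refine separable_of_rootMultiplicity_le_one (monic_addDeriv_iterate hp c n).ne_zero
    (splits_addDeriv_iterate hp hs c n) fun r => ?_
  have h1 := rootMultiplicity_addDeriv_iterate_le hp hs hc r n
  have h2 := rootMultiplicity_le_one_of_separable hsep r
  omega

end RealRooted

section Hyperbolic

/-- Ternary forms all of whose non-trivial restrictions have simple real roots. -/
def strictlyHyperbolic (m : ℕ) : Set (TernaryCoeff m) :=
  {e | ∀ y z : ℝ, y ≠ 0 ∨ z ≠ 0 → (ternary e y z).Splits ∧ (ternary e y z).Separable}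

theorem splits_and_separable_of_card {p : ℝ[X]} (hp : p ≠ 0) {R : Finset ℝ}
    (hR : p.natDegree ≤ R.card) (hroot : ∀ r ∈ R, p.IsRoot r) : p.Splits ∧ p.Separable := by
  have hle : R.val ≤ p.roots :=
    (Multiset.le_iff_subset R.nodup).2 fun r hr => (mem_roots hp).2 (hroot r hr)
  have heq : R.val = p.roots :=
    Multiset.eq_of_le_of_card_le hle ((card_roots' p).trans hR)
  have hs : p.Splits := by
    rw [splits_iff_card_roots, ← heq]
    exact le_antisymm ((Multiset.card_le_card hle).trans (card_roots' p)) hR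
  exact ⟨hs, (nodup_roots_iff_of_splits hp hs).1 (heq ▸ R.nodup)⟩

theorem exists_separation (R : Finset ℝ) :
    ∃ ε : ℝ, 0 < ε ∧ ∀ r ∈ R, ∀ r' ∈ R, r ≠ r' → 2 * ε < |r - r'| := by
  have h : ∀ᶠ ε in nhdsWithin (0 : ℝ) (Set.Ioi 0),
      ∀ r ∈ R, ∀ r' ∈ R, r ≠ r' → 2 * ε < |r - r'| := by
    rw [Filter.eventually_all_finset]
    intro r _
    rw [Filter.eventually_all_finset]
    intro r' _
    rw [Filter.eventually_imp_distrib_left]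
    intro hne
    have h0 : ∀ᶠ ε in nhds (0 : ℝ), 2 * ε < |r - r'| := by
      refine (by fun_prop : Continuous fun ε : ℝ => 2 * ε).continuousAt.eventually_lt
        continuousAt_const ?_
      simpa using sub_ne_zero.2 hne
    exact h0.filter_mono nhdsWithin_le_nhds
  obtain ⟨ε, h1, h2⟩ := (h.and self_mem_nhdsWithin).exists
  exact ⟨ε, h2, h1⟩

theorem eval_sub_mul_eval_add_neg {R : Finset ℝ} {ε : ℝ} (hε : 0 < ε)
    (hR : ∀ r ∈ R, ∀ r' ∈ R, r ≠ r' → 2 * ε < |r - r'|) {r : ℝ} (hr : r ∈ R) :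
    (∏ a ∈ R, (r - ε - a)) * ∏ a ∈ R, (r + ε - a) < 0 := by
  classical
  rw [← Finset.prod_mul_distrib, ← Finset.mul_prod_erase R _ hr]
  refine mul_neg_of_neg_of_pos (by nlinarith) (Finset.prod_pos fun a ha => ?_)
  have h1 := hR r hr a (Finset.mem_of_mem_erase ha) (Finset.ne_of_mem_erase ha).symm
  have h2 : ε ^ 2 < |r - a| ^ 2 := by
    have := abs_nonneg (r - a)
    nlinarith
  rw [sq_abs] at h2
  nlinarith

theorem exists_isRoot_of_mul_neg {p : ℝ[X]} {a b : ℝ} (hab : a ≤ b)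
    (h : p.eval a * p.eval b < 0) : ∃ c ∈ Set.Ioo a b, p.IsRoot c := by
  have ha : p.eval a ≠ 0 := fun h0 => by simp [h0] at h
  have hb : p.eval b ≠ 0 := fun h0 => by simp [h0] at h
  have hcont : ContinuousOn (fun x => p.eval x) (Set.Icc a b) := p.continuous.continuousOn
  have key : ∃ c ∈ Set.Icc a b, p.eval c = 0 := by
    rcases mul_neg_iff.1 h with ⟨h1, h2⟩ | ⟨h1, h2⟩
    · exact intermediate_value_Icc' hab hcont ⟨h2.le, h1.le⟩
    · exact intermediate_value_Icc hab hcont ⟨h1.le, h2.le⟩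
  obtain ⟨c, ⟨hc1, hc2⟩, hc⟩ := key
  refine ⟨c, ⟨lt_of_le_of_ne hc1 ?_, lt_of_le_of_ne hc2 ?_⟩, hc⟩
  · rintro rfl
    exact ha hc
  · rintro rfl
    exact hb hc

theorem splits_and_separable_of_sign_changes {p : ℝ[X]} (hp : p ≠ 0) {R : Finset ℝ}
    (hcard : p.natDegree ≤ R.card) {ε : ℝ} (hε : 0 < ε)
    (hR : ∀ r ∈ R, ∀ r' ∈ R, r ≠ r' → 2 * ε < |r - r'|)
    (hsign : ∀ r ∈ R, p.eval (r - ε) * p.eval (r + ε) < 0) : p.Splits ∧ p.Separable := by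
  classical
  have h : ∀ r, ∃ c, r ∈ R → |c - r| < ε ∧ p.IsRoot c := by
    intro r
    by_cases hr : r ∈ R
    · obtain ⟨c, ⟨h1, h2⟩, hc⟩ := exists_isRoot_of_mul_neg (by linarith) (hsign r hr)
      exact ⟨c, fun _ => ⟨abs_lt.2 ⟨by linarith, by linarith⟩, hc⟩⟩
    · exact ⟨0, fun h => absurd h hr⟩
  choose ρ hρ using h
  refine splits_and_separable_of_card hp (R := R.image ρ) ?_ ?_
  · rwa [Finset.card_image_of_injOn]
    intro r hr r' hr' heq
    by_contra hne
    have h1 := (hρ r hr).1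
    have h2 := (hρ r' hr').1
    have h3 := hR r hr r' hr' hne
    have heq : ρ r = ρ r' := heq
    rw [heq] at h1
    have := abs_sub_le r (ρ r') r'
    rw [abs_sub_comm r (ρ r')] at this
    linarith
  · intro c hc
    obtain ⟨r, hr, rfl⟩ := Finset.mem_image.1 hc
    exact (hρ r hr).2

theorem continuous_eval_ternary (m : ℕ) (x : ℝ) :
    Continuous fun v : TernaryCoeff m × ℝ × ℝ => (ternary v.1 v.2.1 v.2.2).eval x := by
  simp only [ternary, ternaryTail, eval_add, eval_pow, eval_X, eval_finsetSum, eval_mul, eval_C]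
  refine continuous_const.add (continuous_finsetSum _ fun i _ => ?_)
  have : Continuous fun v : TernaryCoeff m × ℝ × ℝ => v.1 i :=
    (continuous_apply i).comp continuous_fst
  fun_prop

theorem eval_ternary_mul {m : ℕ} (e : TernaryCoeff m) (c y z x : ℝ) :
    (ternary e (c * y) (c * z)).eval (c * x) = c ^ m * (ternary e y z).eval x := by
  simp only [ternary, ternaryTail, eval_add, eval_pow, eval_X, eval_finsetSum, eval_mul, eval_C,
    mul_add, Finset.mul_sum, mul_pow]
  refine congrArg₂ _ rfl (Finset.sum_congr rfl fun i _ => ?_)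
  have h : m = (m - i.1 - i.2) + i.2 + i.1 := by
    have h1 := i.1.2
    have h2 := i.2.2
    omega
  have h2 : c ^ m = c ^ (m - i.1 - i.2) * c ^ (i.2 : ℕ) * c ^ (i.1 : ℕ) := by
    rw [← pow_add, ← pow_add, ← h]
  rw [h2]
  ring

theorem splits_and_separable_ternary_mul {m : ℕ} {e : TernaryCoeff m} {y z c : ℝ} (hc : c ≠ 0)
    (h : (ternary e y z).Splits ∧ (ternary e y z).Separable) :
    (ternary e (c * y) (c * z)).Splits ∧ (ternary e (c * y) (c * z)).Separable := by
  classical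
  refine splits_and_separable_of_card (monic_ternary _ _ _).ne_zero
    (R := (ternary e y z).roots.toFinset.image (c * ·)) ?_ ?_
  · rw [Finset.card_image_of_injective _ (mul_right_injective₀ hc),
      Multiset.toFinset_card_of_nodup (nodup_roots h.2), ← h.1.natDegree_eq_card_roots,
      natDegree_ternary, natDegree_ternary]
  · intro r hr
    obtain ⟨x, hx, rfl⟩ := Finset.mem_image.1 hr
    rw [Multiset.mem_toFinset, mem_roots (monic_ternary _ _ _).ne_zero, IsRoot.def] at hx
    rw [IsRoot.def, eval_ternary_mul, hx, mul_zero]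

theorem isOpen_strictlyHyperbolic (m : ℕ) : IsOpen (strictlyHyperbolic m) := by
  classical
  rw [isOpen_iff_mem_nhds]
  intro e he
  have hloc : ∀ v ∈ Metric.sphere (0 : ℝ × ℝ) 1,
      ∀ᶠ w : TernaryCoeff m × ℝ × ℝ in nhds (e, v),
        (ternary w.1 w.2.1 w.2.2).Splits ∧ (ternary w.1 w.2.1 w.2.2).Separable := by
    rintro ⟨y, z⟩ hv
    have hyz : y ≠ 0 ∨ z ≠ 0 := by
      by_contra! h
      simp [h.1, h.2] at hv
    obtain ⟨hs, hsep⟩ := he y z hyz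
    set p := ternary e y z with hp
    obtain ⟨ε, hε, hR⟩ := exists_separation p.roots.toFinset
    have hcard : p.roots.toFinset.card = m := by
      rw [Multiset.toFinset_card_of_nodup (nodup_roots hsep), ← hs.natDegree_eq_card_roots,
        hp, natDegree_ternary]
    have hev : ∀ x, p.eval x = ∏ a ∈ p.roots.toFinset, (x - a) := by
      intro x
      rw [hs.eval_eq_prod_roots_of_monic (monic_ternary _ _ _), Finset.prod,
        Multiset.toFinset_val, (nodup_roots hsep).dedup]
    have hsign : ∀ᶠ w : TernaryCoeff m × ℝ × ℝ in nhds (e, y, z), ∀ r ∈ p.roots.toFinset,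
        (ternary w.1 w.2.1 w.2.2).eval (r - ε) * (ternary w.1 w.2.1 w.2.2).eval (r + ε) < 0 := by
      rw [Filter.eventually_all_finset]
      intro r hr
      refine ((continuous_eval_ternary m _).mul
        (continuous_eval_ternary m _)).continuousAt.eventually_lt continuousAt_const ?_
      have := eval_sub_mul_eval_add_neg hε hR hr
      rwa [← hev, ← hev] at this
    filter_upwards [hsign] with w hw
    exact splits_and_separable_of_sign_changes (monic_ternary _ _ _).ne_zero
      (by rw [natDegree_ternary, hcard]) hε hR hw
  filter_upwards [(isCompact_sphere (0 : ℝ × ℝ) 1).eventually_forall_of_forall_eventually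
    (P := fun e v => (ternary e v.1 v.2).Splits ∧ (ternary e v.1 v.2).Separable) hloc]
    with e' he' y z hyz
  have hne : ‖((y, z) : ℝ × ℝ)‖ ≠ 0 := by
    rw [norm_ne_zero_iff]
    intro h
    rw [Prod.mk_eq_zero] at h
    exact hyz.elim (fun h1 => h1 h.1) (fun h1 => h1 h.2)
  have hsph : ‖((y, z) : ℝ × ℝ)‖⁻¹ • ((y, z) : ℝ × ℝ) ∈ Metric.sphere (0 : ℝ × ℝ) 1 := by
    rw [mem_sphere_zero_iff_norm, norm_smul, norm_inv, norm_norm, inv_mul_cancel₀ hne]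
  have h := splits_and_separable_ternary_mul hne (he' _ hsph)
  rwa [Prod.smul_fst, Prod.smul_snd, smul_eq_mul, smul_eq_mul, mul_inv_cancel_left₀ hne,
    mul_inv_cancel_left₀ hne] at h

/-- A family of binary forms of degree `d`, with coefficients depending continuously on a
parameter. -/
def IsFormFamily {T : Type*} [TopologicalSpace T] (d : ℕ) (g : T → ℝ → ℝ → ℝ) : Prop :=
  ∃ c : ℕ → T → ℝ, (∀ j, Continuous (c j)) ∧
    ∀ t y z, g t y z = ∑ j ∈ Finset.range (d + 1), c j t * (y ^ (d - j) * z ^ j)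

/-- A family of monic polynomials of degree `m` whose coefficients are binary forms making the
whole polynomial homogeneous of degree `m`. -/
structure IsTernaryFamily {T : Type*} [TopologicalSpace T] (m : ℕ) (G : T → ℝ → ℝ → ℝ[X]) :
    Prop where
  monic : ∀ t y z, (G t y z).Monic
  natDegree_eq : ∀ t y z, (G t y z).natDegree = m
  coeff : ∀ k ≤ m, IsFormFamily (m - k) fun t y z => (G t y z).coeff k

variable {T : Type*} [TopologicalSpace T]

theorem IsFormFamily.add {d : ℕ} {g g' : T → ℝ → ℝ → ℝ} (hg : IsFormFamily d g)
    (hg' : IsFormFamily d g') : IsFormFamily d fun t y z => g t y z + g' t y z := by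
  obtain ⟨c, hc, h⟩ := hg
  obtain ⟨c', hc', h'⟩ := hg'
  refine ⟨fun j t => c j t + c' j t, fun j => (hc j).add (hc' j), fun t y z => ?_⟩
  beta_reduce
  rw [h, h', ← Finset.sum_add_distrib]
  exact Finset.sum_congr rfl fun j _ => by ring

theorem IsFormFamily.const_mul {d : ℕ} {g : T → ℝ → ℝ → ℝ} (hg : IsFormFamily d g) {f : T → ℝ}
    (hf : Continuous f) : IsFormFamily d fun t y z => f t * g t y z := by
  obtain ⟨c, hc, h⟩ := hg
  refine ⟨fun j t => f t * c j t, fun j => hf.mul (hc j), fun t y z => ?_⟩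
  beta_reduce
  rw [h, Finset.mul_sum]
  exact Finset.sum_congr rfl fun j _ => by ring

theorem IsFormFamily.fst_mul {d : ℕ} {g : T → ℝ → ℝ → ℝ} (hg : IsFormFamily d g) :
    IsFormFamily (d + 1) fun t y z => y * g t y z := by
  obtain ⟨c, hc, h⟩ := hg
  refine ⟨fun j t => if j ≤ d then c j t else 0, fun j => ?_, fun t y z => ?_⟩
  · beta_reduce
    split_ifs
    · exact hc j
    · exact continuous_const
  beta_reduce
  rw [h, Finset.mul_sum, Finset.sum_range_succ _ (d + 1), if_neg (by omega), zero_mul, add_zero]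
  refine Finset.sum_congr rfl fun j hj => ?_
  have hj : j ≤ d := by have := Finset.mem_range.1 hj; omega
  rw [if_pos hj, Nat.succ_sub hj, pow_succ]
  ring

theorem IsFormFamily.snd_mul {d : ℕ} {g : T → ℝ → ℝ → ℝ} (hg : IsFormFamily d g) :
    IsFormFamily (d + 1) fun t y z => z * g t y z := by
  obtain ⟨c, hc, h⟩ := hg
  refine ⟨fun j t => if j = 0 then 0 else c (j - 1) t, fun j => ?_, fun t y z => ?_⟩
  · beta_reduce
    split_ifs
    · exact continuous_const
    · exact hc _
  beta_reduce
  rw [h, Finset.mul_sum, Finset.sum_range_succ' _ (d + 1), if_pos rfl, zero_mul, add_zero]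
  refine Finset.sum_congr rfl fun j hj => ?_
  rw [if_neg (by omega), Nat.add_sub_cancel, Nat.add_sub_add_right, pow_succ]
  ring

theorem isFormFamily_const (a : ℝ) : IsFormFamily (T := T) 0 fun _ _ _ => a :=
  ⟨fun _ _ => a, fun _ => continuous_const, fun t y z => by simp⟩

theorem IsTernaryFamily.coeff_top {m : ℕ} {G : T → ℝ → ℝ → ℝ[X]}
    (hm : ∀ t y z, (G t y z).Monic) (hd : ∀ t y z, (G t y z).natDegree = m) :
    IsFormFamily (m - m) fun t y z => (G t y z).coeff m := by
  have h : (fun t y z => (G t y z).coeff m) = fun _ _ _ => 1 := by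
    funext t y z
    conv_lhs => rw [← hd t y z]
    exact hm t y z
  rw [h, Nat.sub_self]
  exact isFormFamily_const 1

theorem IsTernaryFamily.exists_ternary {m : ℕ} {G : T → ℝ → ℝ → ℝ[X]}
    (hG : IsTernaryFamily m G) :
    ∃ γ : T → TernaryCoeff m, Continuous γ ∧ ∀ t y z, ternary (γ t) y z = G t y z := by
  have h : ∀ k : Fin m, IsFormFamily (m - k) fun t y z => (G t y z).coeff k :=
    fun k => hG.coeff k k.2.le
  choose c hc hcoeff using h
  refine ⟨fun t i => c i.1 i.2 t, continuous_pi fun i => hc i.1 i.2, fun t y z => ?_⟩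
  refine eq_ternary_of_coeff (hG.monic t y z) (hG.natDegree_eq t y z) fun k => ?_
  exact (hcoeff k t y z).trans (Finset.sum_range _)

theorem IsTernaryFamily.addDeriv {m : ℕ} {G : T → ℝ → ℝ → ℝ[X]} (hG : IsTernaryFamily m G)
    {f : T → ℝ → ℝ → ℝ}
    (hf : ∀ d g, IsFormFamily d g → IsFormFamily (d + 1) fun t y z => f t y z * g t y z) :
    IsTernaryFamily m fun t y z => addDeriv (f t y z) (G t y z) where
  monic t y z := monic_addDeriv (hG.monic t y z) _
  natDegree_eq t y z := by rw [natDegree_addDeriv (hG.monic t y z), hG.natDegree_eq]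
  coeff k hk := by
    rcases hk.eq_or_lt with rfl | hk'
    · exact IsTernaryFamily.coeff_top (fun t y z => monic_addDeriv (hG.monic t y z) _)
        fun t y z => by rw [natDegree_addDeriv (hG.monic t y z), hG.natDegree_eq]
    have h1 := hf _ _ ((hG.coeff (k + 1) hk').const_mul (f := fun _ => (k : ℝ) + 1)
      continuous_const)
    rw [show m - (k + 1) + 1 = m - k by omega] at h1
    have h := (hG.coeff k hk).add h1
    convert h using 4
    simp only [_root_.addDeriv, coeff_add, coeff_C_mul, coeff_derivative]
    ring

theorem IsTernaryFamily.addDeriv_iterate {m : ℕ} {G : T → ℝ → ℝ → ℝ[X]}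
    (hG : IsTernaryFamily m G) {f : T → ℝ → ℝ → ℝ}
    (hf : ∀ d g, IsFormFamily d g → IsFormFamily (d + 1) fun t y z => f t y z * g t y z)
    (n : ℕ) : IsTernaryFamily m fun t y z => (_root_.addDeriv (f t y z))^[n] (G t y z) := by
  induction n with
  | zero => exact hG
  | succ n ih =>
    simp only [Function.iterate_succ_apply']
    exact ih.addDeriv hf

theorem isTernaryFamily_ternary_mul {m : ℕ} (e : TernaryCoeff m) {f : T → ℝ}
    (hf : Continuous f) : IsTernaryFamily m fun t y z => ternary e (f t * y) (f t * z) where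
  monic t y z := monic_ternary _ _ _
  natDegree_eq t y z := natDegree_ternary _ _ _
  coeff k hk := by
    rcases hk.eq_or_lt with rfl | hk'
    · exact IsTernaryFamily.coeff_top (fun t y z => monic_ternary _ _ _)
        fun t y z => natDegree_ternary _ _ _
    refine ⟨fun j t => if h : j < m - k + 1 then e ⟨⟨k, hk'⟩, ⟨j, h⟩⟩ * f t ^ (m - k) else 0,
      fun j => ?_, fun t y z => ?_⟩
    · beta_reduce
      split_ifs
      · fun_prop
      · exact continuous_const
    have h := coeff_ternaryTail e (f t * y) (f t * z) ⟨k, hk'⟩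
    simp only at h ⊢
    rw [ternary, coeff_add, coeff_X_pow, if_neg hk'.ne, zero_add, h, Finset.sum_range]
    refine Finset.sum_congr rfl fun j _ => ?_
    rw [dif_pos j.2, mul_pow, mul_pow]
    have h3 : f t ^ (m - k) = f t ^ (m - k - j) * f t ^ (j : ℕ) := by
      rw [← pow_add]
      congr 1
      have := j.2
      omega
    rw [h3]
    ring

theorem ternary_zero_zero {m : ℕ} (e : TernaryCoeff m) : ternary e 0 0 = X ^ m := by
  rw [ternary, ternaryTail, Finset.sum_eq_zero, add_zero]
  intro i _
  have h : (0 : ℝ) ^ (m - i.1 - i.2) * 0 ^ (i.2 : ℕ) = 0 := by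
    rw [← pow_add, zero_pow]
    have := i.1.2
    omega
  rw [h, mul_zero, C_0, zero_mul]

/-- A path of ternary forms leading from a given one to a fixed one. -/
theorem exists_path_ternary {m : ℕ} (e : TernaryCoeff m) :
    ∃ γ : ℝ → TernaryCoeff m, Continuous γ ∧ ∀ t y z, ternary (γ t) y z =
      (addDeriv (t * y))^[m] ((addDeriv (t * z))^[m] (ternary e ((1 - t) * y) ((1 - t) * z))) := by
  refine (((isTernaryFamily_ternary_mul e (f := fun t : ℝ => 1 - t) (by fun_prop)).addDeriv_iterate
    (f := fun t y z => t * z) ?_ m).addDeriv_iterate (f := fun t y z => t * y) ?_ m).exists_ternary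
  · intro d g hg
    have := (hg.snd_mul).const_mul (f := fun t : ℝ => t) continuous_id
    simpa only [mul_assoc] using this
  · intro d g hg
    have := (hg.fst_mul).const_mul (f := fun t : ℝ => t) continuous_id
    simpa only [mul_assoc] using this

theorem mem_strictlyHyperbolic_of_path {m : ℕ} {e e' : TernaryCoeff m} {t : ℝ} (ht : t ≠ 0)
    (he : ∀ y z, (ternary e y z).Splits)
    (h : ∀ y z, ternary e' y z =
      (addDeriv (t * y))^[m] ((addDeriv (t * z))^[m] (ternary e ((1 - t) * y) ((1 - t) * z)))) :
    e' ∈ strictlyHyperbolic m := by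
  intro y z hyz
  rw [h]
  have hm := monic_ternary e ((1 - t) * y) ((1 - t) * z)
  have hd := natDegree_ternary e ((1 - t) * y) ((1 - t) * z)
  have hs := he ((1 - t) * y) ((1 - t) * z)
  have hm2 := monic_addDeriv_iterate hm (t * z) m
  have hs2 := splits_addDeriv_iterate hm hs (t * z) m
  refine ⟨splits_addDeriv_iterate hm2 hs2 _ _, ?_⟩
  by_cases hy : y = 0
  · have hz : z ≠ 0 := hyz.resolve_left (not_not_intro hy)
    exact separable_addDeriv_iterate_of_separable hm2 hs2
      (separable_addDeriv_iterate hm hs (mul_ne_zero ht hz) hd.le) _ _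
  · exact separable_addDeriv_iterate hm2 hs2 (mul_ne_zero ht hy)
      (by rw [natDegree_addDeriv_iterate hm, hd])

theorem eq_of_path_zero {m : ℕ} {e : TernaryCoeff m} {γ : ℝ → TernaryCoeff m}
    (h : ∀ t y z, ternary (γ t) y z =
      (addDeriv (t * y))^[m] ((addDeriv (t * z))^[m] (ternary e ((1 - t) * y) ((1 - t) * z)))) :
    γ 0 = e := by
  refine ternary_injective fun z => ?_
  rw [h, zero_mul, zero_mul, Function.iterate_fixed (addDeriv_zero _),
    Function.iterate_fixed (addDeriv_zero _)]
  simp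

theorem mem_closure_strictlyHyperbolic {m : ℕ} {e : TernaryCoeff m}
    (he : ∀ y z, (ternary e y z).Splits) : e ∈ closure (strictlyHyperbolic m) := by
  obtain ⟨γ, hγ, h⟩ := exists_path_ternary e
  have h0 := eq_of_path_zero h
  have hlim : Filter.Tendsto γ (nhdsWithin 0 (Set.Ioi 0)) (nhds e) := by
    rw [← h0]
    exact hγ.continuousAt.mono_left nhdsWithin_le_nhds
  refine mem_closure_of_tendsto hlim ?_
  filter_upwards [self_mem_nhdsWithin] with t ht
  exact mem_strictlyHyperbolic_of_path (ne_of_gt ht) he (h t)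

theorem isPreconnected_strictlyHyperbolic (m : ℕ) : IsPreconnected (strictlyHyperbolic m) := by
  obtain ⟨γ₀, -, h₀⟩ := exists_path_ternary (0 : TernaryCoeff m)
  refine isPreconnected_of_forall (γ₀ 1) fun e he => ?_
  obtain ⟨γ, hγ, h⟩ := exists_path_ternary e
  have hs : ∀ y z, (ternary e y z).Splits := by
    intro y z
    by_cases hyz : y ≠ 0 ∨ z ≠ 0
    · exact (he y z hyz).1
    · push Not at hyz
      rw [hyz.1, hyz.2, ternary_zero_zero]
      exact Splits.X_pow m
  refine ⟨γ '' Set.Icc 0 1, ?_, ⟨1, by simp, ?_⟩, ⟨0, by simp, eq_of_path_zero h⟩,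
    isPreconnected_Icc.image _ hγ.continuousOn⟩
  · rintro _ ⟨t, ht, rfl⟩
    by_cases ht0 : t = 0
    · rw [ht0, eq_of_path_zero h]
      exact he
    · exact mem_strictlyHyperbolic_of_path ht0 hs (h t)
  · refine ternary_injective fun z => ?_
    rw [h, h₀, sub_self, zero_mul, zero_mul, ternary_zero_zero, ternary_zero_zero]

end Hyperbolic

section HyperbolicDeterminantal

theorem Matrix.IsSymm.splits_charpoly {n : Type*} [Fintype n] [DecidableEq n]
    {M : Matrix n n ℝ} (hM : M.IsSymm) : M.charpoly.Splits := by
  obtain ⟨O, r, -, -, -, h⟩ := hM.exists_spectral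
  rw [h]
  exact Splits.prod fun i _ => Splits.X_sub_C _

theorem abs_le_of_isRoot_ternary {m : ℕ} {e : TernaryCoeff m} {y z x : ℝ} (hy : |y| ≤ 1)
    (hz : |z| ≤ 1) (h : (ternary e y z).IsRoot x) : |x| ≤ max 1 (∑ i, |e i|) := by
  by_contra! hlt
  obtain ⟨h1, h2⟩ := max_lt_iff.1 hlt
  have hx : 0 < |x| := by linarith
  simp only [ternary, ternaryTail, IsRoot.def, eval_add, eval_pow, eval_X, eval_finsetSum,
    eval_mul, eval_C] at h
  rcases Nat.eq_zero_or_pos m with rfl | hm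
  · simp at h
  have hpow : |x| ^ m = |x| * |x| ^ (m - 1) := by
    rw [← pow_succ', Nat.sub_add_cancel hm]
  have hle : |x| ^ m ≤ (∑ i, |e i|) * |x| ^ (m - 1) := by
    rw [← abs_pow, eq_neg_of_add_eq_zero_left h, abs_neg, Finset.sum_mul]
    refine (Finset.abs_sum_le_sum_abs _ _).trans (Finset.sum_le_sum fun i _ => ?_)
    rw [abs_mul, abs_mul, abs_mul, abs_pow, abs_pow, abs_pow, mul_assoc]
    refine mul_le_mul_of_nonneg_left ?_ (abs_nonneg _)
    have h3 : |y| ^ (m - i.1 - i.2) * |z| ^ (i.2 : ℕ) ≤ 1 :=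
      mul_le_one₀ (pow_le_one₀ (abs_nonneg _) hy) (by positivity)
        (pow_le_one₀ (abs_nonneg _) hz)
    have h4 : |x| ^ (i.1 : ℕ) ≤ |x| ^ (m - 1) :=
      pow_le_pow_right₀ h1.le (by have := i.1.2; omega)
    calc _ ≤ 1 * |x| ^ (i.1 : ℕ) := mul_le_mul_of_nonneg_right h3 (by positivity)
      _ ≤ _ := by rw [one_mul]; exact h4
  rw [hpow] at hle
  exact absurd (le_of_mul_le_mul_right hle (pow_pos hx _)) (not_le.2 h2)

theorem abs_apply_le_one_of_mul_transpose_eq_one {n : Type*} [Fintype n] [DecidableEq n]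
    {O : Matrix n n ℝ} (hO : O * Oᵀ = 1) (i j : n) : |O i j| ≤ 1 := by
  have h := congrFun (congrFun hO i) i
  rw [Matrix.mul_apply, Matrix.one_apply_eq] at h
  rw [← sq_le_one_iff_abs_le_one, ← h, sq]
  exact Finset.single_le_sum (f := fun k => O i k * Oᵀ k i)
    (fun k _ => mul_self_nonneg (O i k)) (Finset.mem_univ j)

variable {m : ℕ} {F : DiagSym m → TernaryCoeff m}

theorem norm_le_of_ternary_eq_charpoly
    (hch : ∀ v y z, ternary (F v) y z = (y • diagonal v.1 + z • symMatrix v.2).charpoly)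
    (v : DiagSym m) : ‖v‖ ≤ (m + 1) * max 1 (∑ i, |F v i|) := by
  set M := max 1 (∑ i, |F v i|)
  have hM : 1 ≤ M := le_max_left _ _
  have h1 : ∀ i, |v.1 i| ≤ M := by
    intro i
    refine abs_le_of_isRoot_ternary (y := 1) (z := 0) (by simp) (by simp) ?_
    rw [hch, one_smul, zero_smul, add_zero, charpoly_diagonal, IsRoot.def, eval_prod]
    exact Finset.prod_eq_zero (Finset.mem_univ i) (by simp)
  have h2 : ∀ i j, |symMatrix v.2 i j| ≤ m * M := by
    obtain ⟨O, r, hO, -, hB, hr⟩ := (isSymm_symMatrix v.2).exists_spectral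
    have hrM : ∀ i, |r i| ≤ M := by
      intro i
      refine abs_le_of_isRoot_ternary (y := 0) (z := 1) (by simp) (by simp) ?_
      rw [hch, one_smul, zero_smul, zero_add, hr, IsRoot.def, eval_prod]
      exact Finset.prod_eq_zero (Finset.mem_univ i) (by simp)
    intro i j
    rw [hB, Matrix.mul_apply]
    refine (Finset.abs_sum_le_sum_abs _ _).trans ?_
    have : (m : ℝ) * M = ∑ _k : Fin m, M := by simp
    rw [this]
    refine Finset.sum_le_sum fun k _ => ?_
    rw [mul_diagonal, transpose_apply, abs_mul, abs_mul]
    have h3 := abs_apply_le_one_of_mul_transpose_eq_one hO i k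
    have h4 := abs_apply_le_one_of_mul_transpose_eq_one hO j k
    calc |O i k| * |r k| * |O j k| ≤ 1 * M * 1 := by
          gcongr
          exact hrM k
      _ = M := by ring
  have hm : (0 : ℝ) ≤ m := Nat.cast_nonneg m
  refine norm_prod_le_iff.2 ⟨?_, ?_⟩
  · refine (pi_norm_le_iff_of_nonneg (by positivity)).2 fun i => ?_
    rw [Real.norm_eq_abs]
    nlinarith [h1 i]
  · refine (pi_norm_le_iff_of_nonneg (by positivity)).2 fun s => ?_
    induction s using Sym2.ind with
    | _ i j =>
      have h5 : |v.2 s(i, j)| ≤ m * M := h2 i j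
      rw [Real.norm_eq_abs]
      linarith

theorem isClosed_range_of_ternary_eq_charpoly (hF : Continuous F)
    (hch : ∀ v y z, ternary (F v) y z = (y • diagonal v.1 + z • symMatrix v.2).charpoly) :
    IsClosed (Set.range F) := by
  refine isClosed_of_closure_subset fun e he => ?_
  let S : TernaryCoeff m → ℝ := fun e => ∑ i, |e i|
  have hS : Continuous S := by fun_prop
  have hW : IsOpen {e' | S e' < S e + 1} := isOpen_lt hS continuous_const
  have h1 := hW.inter_closure ⟨show S e < S e + 1 by linarith, he⟩
  have hK : IsCompact (F '' Metric.closedBall 0 ((m + 1) * max 1 (S e + 1))) :=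
    (isCompact_closedBall _ _).image hF
  have h2 : {e' | S e' < S e + 1} ∩ Set.range F ⊆
      F '' Metric.closedBall 0 ((m + 1) * max 1 (S e + 1)) := by
    rintro _ ⟨hlt, v, rfl⟩
    refine ⟨v, mem_closedBall_zero_iff.2 ((norm_le_of_ternary_eq_charpoly hch v).trans ?_), rfl⟩
    have hlt : S (F v) < S e + 1 := hlt
    exact mul_le_mul_of_nonneg_left (max_le_max le_rfl hlt.le) (by positivity)
  exact Set.image_subset_range _ _ (hK.isClosed.closure_subset_iff.2 h2 h1)

/-- Every monic ternary form that is hyperbolic is the characteristic polynomial of a pencil of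
real symmetric matrices. -/
theorem exists_charpoly_eq_ternary {m : ℕ} {e : TernaryCoeff m}
    (he : ∀ y z, (ternary e y z).Splits) :
    ∃ v : DiagSym m, ∀ y z, (y • diagonal v.1 + z • symMatrix v.2).charpoly = ternary e y z := by
  obtain ⟨F, hF, hch⟩ := exists_analytic_ternary_eq_charpoly m
  have hdiff : Differentiable ℝ F := fun v => (hF v (Set.mem_univ v)).differentiableAt
  have hcl := isClosed_range_of_ternary_eq_charpoly hdiff.continuous hch
  obtain ⟨v₀, hno, hsep⟩ := exists_noCommutingSkew m
  have hsub : strictlyHyperbolic m ⊆ Set.range F := by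
    refine subset_range_of_finrank_ker (finrank_diagSym m) hF hcl (isOpen_strictlyHyperbolic m)
      (isPreconnected_strictlyHyperbolic m) (fun v hv => ?_) (v₀ := v₀) (fun y z hyz => ?_)
      (ker_fderiv_eq_bot hdiff hch hsep hno)
    · have hs : ∀ y z : ℝ, y ≠ 0 ∨ z ≠ 0 →
          (y • diagonal v.1 + z • symMatrix v.2).charpoly.Separable := fun y z hyz => by
        rw [← hch]
        exact (hv y z hyz).2
      by_cases hc : NoCommutingSkew (diagonal v.1) (symMatrix v.2)
      · exact Or.inl (ker_fderiv_eq_bot hdiff hch hs hc)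
      · exact Or.inr (two_le_finrank_ker_fderiv hdiff hch hs hc)
    · rw [hch]
      exact ⟨(isSymm_pencil v₀ y z).splits_charpoly, hsep y z hyz⟩
  obtain ⟨v, rfl⟩ := hcl.closure_subset_iff.2 hsub (mem_closure_strictlyHyperbolic he)
  exact ⟨v, fun y z => (hch v y z).symm⟩

end HyperbolicDeterminantal

section Apolar

/-- The polar derivative at `-b` of a polynomial regarded as having degree `n + 1`. -/
noncomputable def polarDeriv (n : ℕ) (b : ℂ) (P : ℂ[X]) : ℂ[X] :=
  C ((n : ℂ) + 1) * P - (X + C b) * derivative P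

/-- The pairing underlying the symmetric additive convolution. -/
noncomputable def apolarPairing (n : ℕ) (P q : ℂ[X]) : ℂ :=
  ∑ i ∈ Finset.range (n + 1),
    (i.factorial * P.coeff i) * ((n - i).factorial * q.coeff (n - i))

theorem coeff_polarDeriv (n : ℕ) (b : ℂ) (P : ℂ[X]) (i : ℕ) :
    (polarDeriv n b P).coeff i = (n + 1 - i) * P.coeff i - b * ((i + 1) * P.coeff (i + 1)) := by
  have h : (X * derivative P).coeff i = i * P.coeff i := by
    cases i with
    | zero => simp
    | succ i =>
      rw [coeff_X_mul, coeff_derivative]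
      push_cast
      ring
  rw [polarDeriv, coeff_sub, add_mul, coeff_add, coeff_C_mul, coeff_C_mul, h, coeff_derivative]
  ring

theorem apolarPairing_succ {n : ℕ} (b : ℂ) (P : ℂ[X]) {q : ℂ[X]} (hq : q.natDegree ≤ n) :
    apolarPairing (n + 1) P ((X - C b) * q) = apolarPairing n (polarDeriv n b P) q := by
  have hX : ∀ i ∈ Finset.range (n + 1),
      (i.factorial * P.coeff i) * ((n + 1 - i).factorial * (X * q).coeff (n + 1 - i)) =
        (i.factorial * ((n + 1 - i) * P.coeff i)) * ((n - i).factorial * q.coeff (n - i)) := by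
    intro i hi
    have hi : i ≤ n := by have := Finset.mem_range.1 hi; omega
    rw [Nat.succ_sub hi, coeff_X_mul, Nat.factorial_succ]
    push_cast [hi]
    ring
  have hsum : apolarPairing (n + 1) P ((X - C b) * q) =
      ∑ i ∈ Finset.range (n + 2),
        (i.factorial * P.coeff i) * ((n + 1 - i).factorial * (X * q).coeff (n + 1 - i)) -
      b * ∑ i ∈ Finset.range (n + 2),
        (i.factorial * P.coeff i) * ((n + 1 - i).factorial * q.coeff (n + 1 - i)) := by
    rw [apolarPairing, Finset.mul_sum, ← Finset.sum_sub_distrib]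
    refine Finset.sum_congr rfl fun i _ => ?_
    rw [sub_mul, coeff_sub, coeff_C_mul]
    ring
  rw [hsum, Finset.sum_range_succ _ (n + 1), Finset.sum_range_succ' _ (n + 1),
    Finset.sum_congr rfl hX, Nat.sub_self, mul_coeff_zero, coeff_X_zero, Nat.sub_zero,
    coeff_eq_zero_of_natDegree_lt (show q.natDegree < n + 1 by omega)]
  simp only [zero_mul, mul_zero, add_zero]
  rw [Finset.mul_sum, ← Finset.sum_sub_distrib, apolarPairing]
  refine Finset.sum_congr rfl fun i _ => ?_
  rw [coeff_polarDeriv, Nat.add_sub_add_right, Nat.factorial_succ]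
  push_cast
  ring

theorem im_polar_term_pos {t s : ℂ} {b : ℝ} (ht : 0 ≤ t.im) (hs : s.im < 0) (hb : t ≠ -b) :
    0 < ((t + b) * (1 - (t + b) * (1 / (t - s)))).im := by
  have hts : t - s ≠ 0 := fun h => by
    have := congrArg Complex.im h
    simp at this
    linarith
  have h1 : (t + b) * (1 - (t + b) * (1 / (t - s))) = -((t + b) * (s + b)) / (t - s) := by
    field_simp
    ring
  rw [h1, div_eq_mul_inv, Complex.inv_def, ← mul_assoc, Complex.im_mul_ofReal]
  refine mul_pos ?_ (inv_pos.2 (Complex.normSq_pos.2 hts))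
  have h2 : 0 < (t.re + b) ^ 2 + t.im ^ 2 := by
    by_contra! h
    have h3 : t.im = 0 := by nlinarith [sq_nonneg (t.re + b), sq_nonneg t.im]
    have h4 : t.re + b = 0 := by nlinarith [sq_nonneg (t.re + b), sq_nonneg t.im]
    exact hb (Complex.ext (by simp; linarith) (by simp [h3]))
  have h5 : (-((t + b) * (s + b)) * (starRingEnd ℂ) (t - s)).im =
      -s.im * ((t.re + b) ^ 2 + t.im ^ 2) + t.im * ((s.re + b) ^ 2 + s.im ^ 2) := by
    simp
    ring
  rw [h5]
  exact add_pos_of_pos_of_nonneg (mul_pos (neg_pos.2 hs) h2) (by positivity)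

theorem im_polar_sum_pos {t : ℂ} {b : ℝ} (ht : 0 ≤ t.im) (hb : t ≠ -b) {s : Multiset ℂ}
    (hs0 : s ≠ 0) (hs : ∀ a ∈ s, a.im < 0) :
    0 < ((t + b) * (s.card - (t + b) * (s.map fun a => 1 / (t - a)).sum)).im := by
  have hsplit : ∀ (a : ℂ) (u : Multiset ℂ),
      (t + b) * (((a ::ₘ u).card : ℂ) - (t + b) * ((a ::ₘ u).map fun a => 1 / (t - a)).sum) =
        (t + b) * (1 - (t + b) * (1 / (t - a))) +
          (t + b) * (u.card - (t + b) * (u.map fun a => 1 / (t - a)).sum) := by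
    intro a u
    rw [Multiset.card_cons, Multiset.map_cons, Multiset.sum_cons]
    push_cast
    ring
  have hle : ∀ u : Multiset ℂ, (∀ a ∈ u, a.im < 0) →
      0 ≤ ((t + b) * (u.card - (t + b) * (u.map fun a => 1 / (t - a)).sum)).im := by
    intro u
    induction u using Multiset.induction with
    | empty => simp
    | cons a u ih =>
      intro hu
      rw [hsplit, Complex.add_im]
      exact add_nonneg (im_polar_term_pos ht (hu a (Multiset.mem_cons_self a u)) hb).le
        (ih fun c hc => hu c (Multiset.mem_cons_of_mem hc))
  obtain ⟨a, ha⟩ := Multiset.exists_mem_of_ne_zero hs0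
  obtain ⟨u, rfl⟩ := Multiset.exists_cons_of_mem ha
  rw [hsplit, Complex.add_im]
  exact add_pos_of_pos_of_nonneg (im_polar_term_pos ht (hs a ha) hb)
    (hle u fun c hc => hs c (Multiset.mem_cons_of_mem hc))

theorem im_sum_neg {s : Multiset ℂ} (hs0 : s ≠ 0) (hs : ∀ a ∈ s, a.im < 0) : s.sum.im < 0 := by
  have hle : ∀ u : Multiset ℂ, (∀ a ∈ u, a.im < 0) → u.sum.im ≤ 0 := by
    intro u
    induction u using Multiset.induction with
    | empty => simp
    | cons a u ih =>
      intro hu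
      rw [Multiset.sum_cons, Complex.add_im]
      linarith [hu a (Multiset.mem_cons_self a u), ih fun c hc => hu c (Multiset.mem_cons_of_mem hc)]
  obtain ⟨a, ha⟩ := Multiset.exists_mem_of_ne_zero hs0
  obtain ⟨u, rfl⟩ := Multiset.exists_cons_of_mem ha
  rw [Multiset.sum_cons, Complex.add_im]
  linarith [hs a ha, hle u fun c hc => hs c (Multiset.mem_cons_of_mem hc)]

variable {n : ℕ} {P : ℂ[X]}

theorem roots_im_neg (hP : ∀ t : ℂ, 0 ≤ t.im → P.eval t ≠ 0) : ∀ a ∈ P.roots, a.im < 0 := by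
  intro a ha
  by_contra! h
  exact hP a h (isRoot_of_mem_roots ha)

theorem natDegree_polarDeriv (hd : P.natDegree = n + 1)
    (hP : ∀ t : ℂ, 0 ≤ t.im → P.eval t ≠ 0) (b : ℝ) : (polarDeriv n b P).natDegree = n := by
  have hsp : P.Splits := IsAlgClosed.splits P
  have hlead : P.coeff (n + 1) ≠ 0 := by
    rw [← hd]
    exact leadingCoeff_ne_zero.2 fun h => by simp [h] at hd
  refine natDegree_eq_of_le_of_coeff_ne_zero ?_ ?_
  · rw [natDegree_le_iff_coeff_eq_zero]
    intro k hk
    rw [coeff_polarDeriv, coeff_eq_zero_of_natDegree_lt (show P.natDegree < k + 1 by omega)]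
    rcases (Nat.succ_le_of_lt hk).eq_or_lt with h | h
    · rw [← h]
      push_cast
      ring
    · rw [coeff_eq_zero_of_natDegree_lt (show P.natDegree < k by omega)]
      ring
  · have hnext := hsp.nextCoeff_eq_neg_sum_roots_mul_leadingCoeff
    rw [nextCoeff_of_natDegree_pos (by omega), leadingCoeff, hd, Nat.add_sub_cancel] at hnext
    rw [coeff_polarDeriv, hnext]
    have h1 := im_sum_neg (hsp.roots_ne_zero (by omega)) (roots_im_neg hP)
    have h2 : ((n : ℂ) + 1 - n) * (-P.coeff (n + 1) * P.roots.sum) -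
        b * ((n + 1) * P.coeff (n + 1)) =
        -(P.coeff (n + 1)) * (P.roots.sum + ((b * (n + 1) : ℝ) : ℂ)) := by
      push_cast
      ring
    rw [h2]
    refine mul_ne_zero (neg_ne_zero.2 hlead) fun h => ?_
    have := congrArg Complex.im h
    rw [Complex.add_im, Complex.ofReal_im, Complex.zero_im] at this
    linarith

/-- Laguerre's theorem on polar derivatives, for a half plane. -/
theorem eval_polarDeriv_ne_zero (hd : P.natDegree = n + 1)
    (hP : ∀ t : ℂ, 0 ≤ t.im → P.eval t ≠ 0) (b : ℝ) (t : ℂ) (ht : 0 ≤ t.im) :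
    (polarDeriv n b P).eval t ≠ 0 := by
  intro h
  have hsp : P.Splits := IsAlgClosed.splits P
  simp only [polarDeriv, eval_sub, eval_mul, eval_add, eval_C, eval_X] at h
  by_cases hb : t = -b
  · rw [hb, neg_add_cancel, zero_mul, sub_zero, ← hb] at h
    exact mul_ne_zero (Nat.cast_add_one_ne_zero n) (hP t ht) h
  have hpos := im_polar_sum_pos ht hb (hsp.roots_ne_zero (by omega)) (roots_im_neg hP)
  rw [← hsp.eval_derivative_div_eval_of_ne_zero (hP t ht), ← hsp.natDegree_eq_card_roots, hd]
    at hpos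
  have hPt := hP t ht
  have h0 : ((n + 1 : ℕ) : ℂ) - (t + b) * (eval t (derivative P) / eval t P) = 0 := by
    push_cast
    field_simp
    linear_combination h
  rw [h0] at hpos
  simp at hpos

theorem apolarPairing_ne_zero (hd : P.natDegree = n) (hP : ∀ t : ℂ, 0 ≤ t.im → P.eval t ≠ 0)
    {s : Multiset ℝ} (hs : s.card = n) :
    apolarPairing n P (s.map fun b : ℝ => X - C (b : ℂ)).prod ≠ 0 := by
  induction s using Multiset.induction generalizing n P with
  | empty =>
    obtain rfl : 0 = n := hs
    have h := hP 0 le_rfl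
    rw [← coeff_zero_eq_eval_zero] at h
    simpa [apolarPairing] using h
  | cons b s ih =>
    rw [Multiset.card_cons] at hs
    subst hs
    rw [Multiset.map_cons, Multiset.prod_cons, apolarPairing_succ]
    · exact ih (natDegree_polarDeriv hd hP b) (eval_polarDeriv_ne_zero hd hP b) rfl
    · have h := natDegree_multiset_prod_X_sub_C_eq_card (s.map fun b : ℝ => (b : ℂ))
      rw [Multiset.map_map, Multiset.card_map] at h
      exact h.le

end Apolar

section Convolution

theorem eval_zero_iterate_derivative (q : ℝ[X]) (k : ℕ) :
    (derivative^[k] q).eval 0 = k.factorial * q.coeff k := by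
  rw [← coeff_zero_eq_eval_zero, coeff_iterate_derivative, zero_add, Nat.descFactorial_self,
    nsmul_eq_mul]

theorem coeff_boxplus (m : ℕ) (p q : ℝ[X]) (k : ℕ) :
    (boxplus m p q).coeff k = (m.factorial : ℝ)⁻¹ * ∑ i ∈ Finset.range (m + 1),
      (m - i).factorial * q.coeff (m - i) * ((k + i).descFactorial i * p.coeff (k + i)) := by
  rw [boxplus, coeff_smul, finsetSum_coeff, smul_eq_mul]
  congr 1
  refine Finset.sum_congr rfl fun i _ => ?_
  rw [coeff_C_mul, eval_zero_iterate_derivative, coeff_iterate_derivative, nsmul_eq_mul]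

variable {m : ℕ} {p q : ℝ[X]}

theorem natDegree_boxplus_le (hp : p.natDegree ≤ m) : (boxplus m p q).natDegree ≤ m := by
  rw [natDegree_le_iff_coeff_eq_zero]
  intro k hk
  rw [coeff_boxplus, Finset.sum_eq_zero, mul_zero]
  intro i _
  rw [coeff_eq_zero_of_natDegree_lt (show p.natDegree < k + i by omega), mul_zero, mul_zero]

theorem coeff_boxplus_self (hp : p.Monic) (hpm : p.natDegree = m) (hq : q.Monic)
    (hqm : q.natDegree = m) : (boxplus m p q).coeff m = 1 := by
  have hp1 : p.coeff m = 1 := by rw [← hpm]; exact hp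
  have hq1 : q.coeff m = 1 := by rw [← hqm]; exact hq
  rw [coeff_boxplus, Finset.sum_eq_single 0]
  · simp only [Nat.sub_zero, add_zero, Nat.descFactorial_zero, hp1, hq1, Nat.cast_one, mul_one]
    exact inv_mul_cancel₀ (Nat.cast_ne_zero.2 m.factorial_ne_zero)
  · intro i _ hi
    rw [coeff_eq_zero_of_natDegree_lt (show p.natDegree < m + i by omega), mul_zero, mul_zero]
  · simp

theorem monic_boxplus (hp : p.Monic) (hpm : p.natDegree = m) (hq : q.Monic)
    (hqm : q.natDegree = m) : (boxplus m p q).Monic :=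
  monic_of_natDegree_le_of_coeff_eq_one m (natDegree_boxplus_le hpm.le)
    (coeff_boxplus_self hp hpm hq hqm)

theorem natDegree_boxplus (hp : p.Monic) (hpm : p.natDegree = m) (hq : q.Monic)
    (hqm : q.natDegree = m) : (boxplus m p q).natDegree = m :=
  natDegree_eq_of_le_of_coeff_ne_zero (natDegree_boxplus_le hpm.le)
    (by rw [coeff_boxplus_self hp hpm hq hqm]; exact one_ne_zero)

theorem aeval_boxplus (m : ℕ) (p q : ℝ[X]) (x : ℂ) :
    aeval x (boxplus m p q) = (m.factorial : ℂ)⁻¹ *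
      apolarPairing m (taylor x (p.map (algebraMap ℝ ℂ))) (q.map (algebraMap ℝ ℂ)) := by
  rw [boxplus, map_smul, map_sum, apolarPairing, Algebra.smul_def]
  congr 1
  · simp
  refine Finset.sum_congr rfl fun i _ => ?_
  have h : ((i.factorial : ℂ) * (taylor x (p.map (algebraMap ℝ ℂ))).coeff i) =
      aeval x (derivative^[i] p) := by
    rw [taylor_coeff, ← eval_map_algebraMap, ← iterate_derivative_map,
      ← factorial_smul_hasseDeriv]
    simp
  rw [h, map_mul, aeval_C, eval_zero_iterate_derivative, coeff_map, mul_comm]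
  simp

/-- Walsh's theorem: the symmetric additive convolution preserves real-rootedness. -/
theorem splits_boxplus (hp : p.Monic) (hpm : p.natDegree = m) (hps : p.Splits) (hq : q.Monic)
    (hqm : q.natDegree = m) (hqs : q.Splits) : (boxplus m p q).Splits := by
  refine splits_of_forall_im_pos (monic_boxplus hp hpm hq hqm).ne_zero fun x hx => ?_
  rw [aeval_boxplus]
  refine mul_ne_zero (inv_ne_zero (Nat.cast_ne_zero.2 m.factorial_ne_zero)) ?_
  have hqp : q.map (algebraMap ℝ ℂ) = (q.roots.map fun b : ℝ => X - C (b : ℂ)).prod := by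
    conv_lhs => rw [hqs.eq_prod_roots_of_monic hq]
    rw [Polynomial.map_multiset_prod, Multiset.map_map]
    simp
  rw [hqp]
  refine apolarPairing_ne_zero ?_ (fun t ht => ?_) (by rw [← hqs.natDegree_eq_card_roots, hqm])
  · rw [natDegree_taylor, natDegree_map, hpm]
  · rw [taylor_eval, eval_map_algebraMap]
    exact aeval_ne_zero_of_splits hp.ne_zero hps (by rw [Complex.add_im]; linarith)

theorem boxplus_X_pow (m : ℕ) (p : ℝ[X]) : boxplus m p (X ^ m) = p := by
  rw [boxplus, Finset.sum_eq_single 0]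
  · rw [Nat.sub_zero, eval_zero_iterate_derivative, coeff_X_pow_self, mul_one,
      Function.iterate_zero_apply, ← smul_eq_C_mul, smul_smul,
      inv_mul_cancel₀ (Nat.cast_ne_zero.2 m.factorial_ne_zero), one_smul]
  · intro i hi h0
    rw [eval_zero_iterate_derivative, coeff_X_pow, if_neg, mul_zero, C_0, zero_mul]
    have := Finset.mem_range.1 hi
    omega
  · simp

theorem X_pow_boxplus (hq : q.natDegree ≤ m) : boxplus m (X ^ m) q = q := by
  ext k
  rw [coeff_boxplus]
  by_cases hk : k ≤ m
  · rw [Finset.sum_eq_single (m - k)]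
    · rw [Nat.sub_sub_self hk, Nat.add_sub_cancel' hk, coeff_X_pow_self, mul_one]
      have h := Nat.factorial_mul_descFactorial (Nat.sub_le m k)
      rw [Nat.sub_sub_self hk] at h
      have hm : (m.factorial : ℝ) ≠ 0 := Nat.cast_ne_zero.2 m.factorial_ne_zero
      have h2 : (k.factorial : ℝ) * (m.descFactorial (m - k)) = m.factorial := by
        exact_mod_cast h
      rw [mul_right_comm, h2, inv_mul_cancel_left₀ hm]
    · intro i hi hne
      rw [coeff_X_pow, if_neg (by omega), mul_zero, mul_zero]
    · intro h
      exact absurd (Finset.mem_range.2 (by omega)) h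
  · rw [coeff_eq_zero_of_natDegree_lt (show q.natDegree < k by omega), Finset.sum_eq_zero,
      mul_zero]
    intro i _
    rw [coeff_X_pow, if_neg (by omega), mul_zero, mul_zero]

theorem coeff_charpoly_smul (y : ℝ) (A : Matrix (Fin m) (Fin m) ℝ) {k : ℕ} (hk : k ≤ m) :
    (y • A).charpoly.coeff k = y ^ (m - k) * A.charpoly.coeff k := by
  have hhom := charpoly.univ_coeff_isHomogeneous ℝ (Fin m) k (m - k)
    (by rw [Fintype.card_fin]; exact Nat.add_sub_of_le hk)
  have h := hhom.eval_mul_const y fun p : Fin m × Fin m => A p.1 p.2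
  have hev : ∀ w : Fin m × Fin m → ℝ,
      MvPolynomial.eval w ((charpoly.univ ℝ (Fin m)).coeff k) =
        (Matrix.of fun i j => w (i, j)).charpoly.coeff k := by
    intro w
    have := charpoly.univ_coeff_eval₂Hom (n := Fin m) (RingHom.id ℝ) w k
    rwa [MvPolynomial.coe_eval₂Hom, MvPolynomial.eval₂_id] at this
  rw [hev, hev] at h
  exact h

theorem isFormFamily_monomial {T : Type*} [TopologicalSpace T] (c : ℝ) {d j : ℕ} (hj : j ≤ d) :
    IsFormFamily (T := T) d fun _ y z => c * (y ^ (d - j) * z ^ j) := by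
  refine ⟨fun i _ => if i = j then c else 0, fun i => continuous_const, fun t y z => ?_⟩
  beta_reduce
  rw [Finset.sum_eq_single j]
  · rw [if_pos rfl]
  · intro i _ hi
    rw [if_neg hi, zero_mul]
  · intro h
    exact absurd (Finset.mem_range.2 (by omega)) h

theorem isFormFamily_sum {T ι : Type*} [TopologicalSpace T] {d : ℕ} {s : Finset ι}
    {g : ι → T → ℝ → ℝ → ℝ} (hg : ∀ i ∈ s, IsFormFamily d (g i)) :
    IsFormFamily d fun t y z => ∑ i ∈ s, g i t y z := by
  classical
  induction s using Finset.induction_on with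
  | empty => exact ⟨fun _ _ => 0, fun _ => continuous_const, fun t y z => by simp⟩
  | insert a s ha ih =>
    simp only [Finset.sum_insert ha]
    exact (hg a (Finset.mem_insert_self a s)).add
      (ih fun i hi => hg i (Finset.mem_insert_of_mem hi))

theorem isTernaryFamily_boxplus_charpoly (A B : Matrix (Fin m) (Fin m) ℝ) :
    IsTernaryFamily (T := Unit) m
      fun _ y z => boxplus m (y • A).charpoly (z • B).charpoly where
  monic _ y z := monic_boxplus (charpoly_monic _) (by simp [charpoly_natDegree_eq_dim])
    (charpoly_monic _) (by simp [charpoly_natDegree_eq_dim])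
  natDegree_eq _ y z := natDegree_boxplus (charpoly_monic _) (by simp [charpoly_natDegree_eq_dim])
    (charpoly_monic _) (by simp [charpoly_natDegree_eq_dim])
  coeff k hk := by
    simp only [coeff_boxplus]
    refine IsFormFamily.const_mul (isFormFamily_sum fun i hi => ?_)
      (f := fun _ => (m.factorial : ℝ)⁻¹) continuous_const
    have hi : i ≤ m := by have := Finset.mem_range.1 hi; omega
    by_cases hik : k + i ≤ m
    · have h := isFormFamily_monomial (T := Unit) ((m - i).factorial * B.charpoly.coeff (m - i) *
        ((k + i).descFactorial i * A.charpoly.coeff (k + i))) (show i ≤ m - k by omega)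
      convert h using 4
      rw [coeff_charpoly_smul _ _ hik, coeff_charpoly_smul _ _ (Nat.sub_le m i),
        Nat.sub_sub_self hi, Nat.sub_add_eq]
      ring
    · refine ⟨fun _ _ => 0, fun _ => continuous_const, fun t y z => ?_⟩
      have h : (y • A).charpoly.coeff (k + i) = 0 :=
        coeff_eq_zero_of_natDegree_lt (by rw [charpoly_natDegree_eq_dim]; simp; omega)
      beta_reduce
      rw [h]
      simp

end Convolution

section OrthogonalSimilarity

theorem charpoly_orthogonal_conj {n : Type*} [Fintype n] [DecidableEq n] {O : Matrix n n ℝ}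
    (hO : O * Oᵀ = 1) (M : Matrix n n ℝ) : (Oᵀ * M * O).charpoly = M.charpoly := by
  rw [Matrix.mul_assoc, charpoly_mul_comm, Matrix.mul_assoc, hO, Matrix.mul_one]

theorem exists_orthogonal_conj_of_charpoly_eq {n : Type*} [Fintype n] [DecidableEq n]
    {M N : Matrix n n ℝ} (hM : M.IsSymm) (hN : N.IsSymm) (h : M.charpoly = N.charpoly) :
    ∃ O : Matrix n n ℝ, O * Oᵀ = 1 ∧ M = Oᵀ * N * O := by
  have hM' : M.IsHermitian := by
    rw [Matrix.IsHermitian, conjTranspose_eq_transpose_of_trivial]; exact hM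
  have hN' : N.IsHermitian := by
    rw [Matrix.IsHermitian, conjTranspose_eq_transpose_of_trivial]; exact hN
  have heig := (hM'.eigenvalues_eq_eigenvalues_iff hN').2 h
  let U : Matrix n n ℝ := ↑hM'.eigenvectorUnitary
  let V : Matrix n n ℝ := ↑hN'.eigenvectorUnitary
  have hU : Uᵀ * U = 1 := by
    rw [← conjTranspose_eq_transpose_of_trivial, ← star_eq_conjTranspose]
    exact Unitary.coe_star_mul_self _
  have hV : V * Vᵀ = 1 := by
    rw [← conjTranspose_eq_transpose_of_trivial, ← star_eq_conjTranspose]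
    exact Unitary.coe_mul_star_self _
  have hV' : Vᵀ * V = 1 := mul_eq_one_comm.1 hV
  have hMs : M = U * diagonal hM'.eigenvalues * Uᵀ := by
    conv_lhs => rw [hM'.spectral_theorem]
    rw [Unitary.conjStarAlgAut_apply, star_eq_conjTranspose,
      conjTranspose_eq_transpose_of_trivial]
    rfl
  have hNs : N = V * diagonal hN'.eigenvalues * Vᵀ := by
    conv_lhs => rw [hN'.spectral_theorem]
    rw [Unitary.conjStarAlgAut_apply, star_eq_conjTranspose,
      conjTranspose_eq_transpose_of_trivial]
    rfl
  refine ⟨V * Uᵀ, ?_, ?_⟩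
  · rw [transpose_mul, transpose_transpose, Matrix.mul_assoc, ← Matrix.mul_assoc Uᵀ, hU,
      Matrix.one_mul, hV]
  · rw [hMs, heig]
    conv_rhs => rw [hNs]
    rw [transpose_mul, transpose_transpose]
    calc U * diagonal hN'.eigenvalues * Uᵀ
        = U * (Vᵀ * V) * diagonal hN'.eigenvalues * (Vᵀ * V) * Uᵀ := by
          rw [hV', Matrix.mul_one, Matrix.mul_one]
      _ = _ := by simp only [Matrix.mul_assoc]

end OrthogonalSimilarity

/-- **Existence of finite free position.** For any `m × m` real symmetric matrices
`A`, `B` there is an orthogonal matrix `R` such that `A` and `RᵀBR` are in finite free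
position. -/
theorem exists_orthogonal_finite_free_position (m : ℕ)
    (A B : Matrix (Fin m) (Fin m) ℝ) (hA : A.IsSymm) (hB : B.IsSymm) :
    ∃ R : Matrix (Fin m) (Fin m) ℝ,
      R * Rᵀ = 1 ∧ FiniteFreePosition m A (Rᵀ * B * R) := by
  obtain ⟨γ, -, hγ⟩ := (isTernaryFamily_boxplus_charpoly A B).exists_ternary
  have hdeg : ∀ M : Matrix (Fin m) (Fin m) ℝ, M.charpoly.natDegree = m := fun M => by
    simp [charpoly_natDegree_eq_dim]
  obtain ⟨v, hv⟩ := exists_charpoly_eq_ternary (e := γ ()) fun y z => by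
    rw [hγ]
    exact splits_boxplus (charpoly_monic _) (hdeg _) (hA.smul y).splits_charpoly
      (charpoly_monic _) (hdeg _) (hB.smul z).splits_charpoly
  simp only [hγ] at hv
  have hD : (diagonal v.1).charpoly = A.charpoly := by
    have h := hv 1 0
    rwa [one_smul, one_smul, zero_smul, zero_smul, add_zero, charpoly_zero, Fintype.card_fin,
      boxplus_X_pow] at h
  have hS : (symMatrix v.2).charpoly = B.charpoly := by
    have h := hv 0 1
    rwa [one_smul, one_smul, zero_smul, zero_smul, zero_add, charpoly_zero, Fintype.card_fin,
      X_pow_boxplus (hdeg B).le] at h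
  obtain ⟨P, hP, hAP⟩ :=
    exists_orthogonal_conj_of_charpoly_eq hA (isSymm_diagonal v.1) hD.symm
  obtain ⟨Q, hQ, hBQ⟩ := exists_orthogonal_conj_of_charpoly_eq (isSymm_symMatrix v.2) hB hS
  have hR : (Q * P) * (Q * P)ᵀ = 1 := by
    rw [transpose_mul, Matrix.mul_assoc, ← Matrix.mul_assoc P, hP, Matrix.one_mul, hQ]
  refine ⟨Q * P, hR, fun y z => ?_⟩
  have hconj : (Q * P)ᵀ * B * (Q * P) = Pᵀ * symMatrix v.2 * P := by
    rw [hBQ, transpose_mul]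
    simp only [Matrix.mul_assoc]
  have h1 : y • A + z • ((Q * P)ᵀ * B * (Q * P)) =
      Pᵀ * (y • diagonal v.1 + z • symMatrix v.2) * P := by
    rw [hconj]
    conv_lhs => rw [hAP]
    simp only [Matrix.mul_add, Matrix.add_mul, Matrix.mul_smul, Matrix.smul_mul]
  have h2 : z • ((Q * P)ᵀ * B * (Q * P)) = (Q * P)ᵀ * (z • B) * (Q * P) := by
    simp only [Matrix.mul_smul, Matrix.smul_mul]
  rw [h1, charpoly_orthogonal_conj hP, hv, h2, charpoly_orthogonal_conj hR]
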